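/- arXiv:1801.10087 — 2 statements merged into one kernel-verified Lean document; each statement's English description precedes it below -/
import Mathlib

section
/- Let 0 < ε < 1 be a constant, let the crossover probability satisfy p_c ≤ 1 − ε, and let the population size satisfy µ ≥ 2n/3 + 1. Then the expected optimization time (number of generations until the global optimum 1^n is created) of the (µ+1) GA with one-point crossover, breaking replacement ties towards removing an individual with the largest number of duplicates, on the real royal road function R_n is O(µn³ + (µ log µ)n + µ²/p_c). In particular, if p_c is a positive constant and µ = O(n), this bound is O(n⁴). -/
open Filter
open scoped ENNReal BigOperators Classical

noncomputable section

abbrev BitString (n : ℕ) := Fin n → Bool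

def onesCount {n : ℕ} (x : BitString n) : ℕ := (Finset.univ.filter fun i => x i = true).card

def allOnes (n : ℕ) : BitString n := fun _ => true
def allZeros (n : ℕ) : BitString n := fun _ => false

def twoMax {n : ℕ} (x : BitString n) : ℕ := max (onesCount x) (n - onesCount x)

/-- probability that standard bit mutation with rate `1/n` creates `y` from `x` -/
def mutProb (n : ℕ) (x y : BitString n) : ℝ≥0∞ :=
  ((n : ℝ≥0∞)⁻¹) ^ hammingDist x y * (1 - (n : ℝ≥0∞)⁻¹) ^ (n - hammingDist x y)

/-- distribution of a (time-homogeneous) finite Markov chain after `t` steps -/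
def evolve {S : Type*} [Fintype S] (init : S → ℝ≥0∞) (trans : S → S → ℝ≥0∞) : ℕ → S → ℝ≥0∞
  | 0 => init
  | t + 1 => fun s' => ∑ s, evolve init trans t s * trans s s'

/-- probability of an event under a (sub)distribution -/
def probOf {S : Type*} [Fintype S] (d : S → ℝ≥0∞) (A : S → Prop) : ℝ≥0∞ :=
  ∑ s, if A s then d s else 0

end

noncomputable section

namespace Stmt14

/-- the `m`-th bit of `x` (`false` for out-of-range indices) -/
def xval {n : ℕ} (x : BitString n) (m : ℕ) : Bool := if h : m < n then x ⟨m, h⟩ else false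

/-- b(x): the length of the longest block of consecutive one-bits in `x` -/
def maxBlock {n : ℕ} (x : BitString n) : ℕ :=
  ((Finset.range (n + 1)).filter fun k =>
    ∃ s, s + k ≤ n ∧ ∀ j < k, xval x (s + j) = true).sup id

/-- the real royal road function Rₙ for one-point crossover -/
def royalRoad {n : ℕ} (x : BitString n) : ℕ :=
  if x = allOnes n then 2 * n ^ 2
  else if onesCount x ≤ 2 * n / 3 then n * onesCount x + maxBlock x
  else 0

/-- one-point crossover of u and v with cut position c: the bits before the cut are
taken from u, the remaining bits from v -/
def onePoint {n : ℕ} (u v : BitString n) (c : Fin (n + 1)) : BitString n := fun i =>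
  if i.val < c.val then u i else v i

/-- mass of the intermediate offspring before mutation: with probability p_c two
parents are chosen uniformly at random and recombined by one-point crossover with a
uniform cut position, otherwise a single parent is chosen uniformly at random -/
def midMass {n μ : ℕ} (pc : ℝ) (P : Fin μ → BitString n) (mid : BitString n) : ℝ≥0∞ :=
  ENNReal.ofReal pc *
    (∑ i₁ : Fin μ, ∑ i₂ : Fin μ, ((μ : ℝ≥0∞)⁻¹ * (μ : ℝ≥0∞)⁻¹) *
      ∑ c : Fin (n + 1), ((n : ℝ≥0∞) + 1)⁻¹ *
        (if mid = onePoint (P i₁) (P i₂) c then 1 else 0)) +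
  ENNReal.ofReal (1 - pc) *
    ∑ i : Fin μ, (μ : ℝ≥0∞)⁻¹ * (if mid = P i then 1 else 0)

/-- number of duplicates of individual `j` in P ∪ {y} -/
def dup {n m : ℕ} (all : Fin m → BitString n) (j : Fin m) : ℕ :=
  (Finset.univ.filter fun j' => all j' = all j).card

/-- the individuals of P ∪ {y} eligible for removal: among the individuals of worst
fitness, those having the largest number of duplicates in P ∪ {y} -/
def removalSet {n μ : ℕ} (f : BitString n → ℕ) (all : Fin (μ + 1) → BitString n) :
    Finset (Fin (μ + 1)) :=
  let W := Finset.univ.filter fun j => ∀ i', f (all j) ≤ f (all i')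
  W.filter fun j => ∀ j' ∈ W, dup all j' ≤ dup all j

/-- the population obtained by removing individual `j` from P ∪ {y} -/
def removeAt {n μ : ℕ} (P : Fin μ → BitString n) (y : BitString n) (j : Fin (μ + 1)) :
    Fin μ → BitString n :=
  if h : j.val < μ then Function.update P ⟨j.val, h⟩ y else P

/-- State of a run: the current population together with a flag recording whether the
global optimum 1ⁿ has been created (as an initial member or as an offspring). -/
abbrev State (n μ : ℕ) := (Fin μ → BitString n) × Bool

/-- One generation of the (μ+1) GA on Rₙ with one-point crossover (crossover
probability pc) and standard bit mutation: from the population together with the new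
offspring, an individual of worst fitness is removed, breaking ties towards removing
an individual with the largest number of duplicates. -/
def trans (n μ : ℕ) (pc : ℝ) : State n μ → State n μ → ℝ≥0∞ := fun s s' =>
  ∑ mid : BitString n, midMass pc s.1 mid * ∑ y : BitString n, mutProb n mid y *
    (let all : Fin (μ + 1) → BitString n := Fin.snoc s.1 y
     ∑ j ∈ removalSet royalRoad all, ((removalSet royalRoad all).card : ℝ≥0∞)⁻¹ *
       (if s'.1 = removeAt s.1 y j ∧ s'.2 = (s.2 || decide (y = allOnes n))
         then 1 else 0))

/-- Initialization: uniform over all populations of μ bit strings of length n. -/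
def init (n μ : ℕ) : State n μ → ℝ≥0∞ := fun s =>
  ((2 : ℝ≥0∞) ^ (n * μ))⁻¹ * (if s.2 = decide (∃ i, s.1 i = allOnes n) then 1 else 0)

/-- expected number of generations until the global optimum 1ⁿ of Rₙ is created -/
def expOpt (n μ : ℕ) (pc : ℝ) : ℝ≥0∞ :=
  ∑' T : ℕ, probOf (evolve (init n μ) (trans n μ pc) T) fun s => ¬ s.2 = true

lemma drift {S : Type*} [Fintype S] (init : S → ℝ≥0∞) (trans : S → S → ℝ≥0∞) (A : S → Prop)
    (V : S → ℝ≥0∞)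
    (h : ∀ s, ∑ s', trans s s' * V s' + (if A s then 1 else 0) ≤ V s) :
    ∑' T, probOf (evolve init trans T) A ≤ ∑ s, init s * V s := by
  have key : ∀ N, ∑ T ∈ Finset.range N, probOf (evolve init trans T) A
      + ∑ s, evolve init trans N s * V s ≤ ∑ s, init s * V s := by
    intro N
    induction N with
    | zero => simp [evolve]
    | succ N ih =>
      refine le_trans ?_ ih
      rw [Finset.sum_range_succ, add_assoc]
      gcongr
      have e1 : ∑ s, evolve init trans (N+1) s * V s
          = ∑ s, evolve init trans N s * ∑ s', trans s s' * V s' := by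
        simp only [evolve, Finset.sum_mul, Finset.mul_sum]
        rw [Finset.sum_comm]
        simp only [mul_assoc]
      rw [e1, probOf, ← Finset.sum_add_distrib]
      refine Finset.sum_le_sum fun s _ => ?_
      calc _ = evolve init trans N s * (∑ s', trans s s' * V s' + (if A s then 1 else 0)) := by
            rw [mul_add, add_comm]; congr 1; split_ifs <;> simp
        _ ≤ _ := by gcongr; exact h s
  exact ENNReal.tsum_le_of_sum_range_le fun N => le_trans le_self_add (key N)

lemma midMass_sum {n μ : ℕ} (pc : ℝ) (h0 : 0 ≤ pc) (h1 : pc ≤ 1) (P : Fin μ → BitString n) :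
    ∑ mid, midMass pc P mid ≤ 1 := by
  have hμ : (μ : ℝ≥0∞) * (μ : ℝ≥0∞)⁻¹ ≤ 1 := ENNReal.mul_inv_le_one _
  have hn : ((n : ℝ≥0∞) + 1) * ((n : ℝ≥0∞) + 1)⁻¹ ≤ 1 := ENNReal.mul_inv_le_one _
  have e : ∑ mid, midMass pc P mid = ENNReal.ofReal pc *
      (((μ : ℝ≥0∞) * (μ : ℝ≥0∞)⁻¹) * ((μ : ℝ≥0∞) * (μ : ℝ≥0∞)⁻¹) *
        (((n : ℝ≥0∞) + 1) * ((n : ℝ≥0∞) + 1)⁻¹)) +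
      ENNReal.ofReal (1 - pc) * ((μ : ℝ≥0∞) * (μ : ℝ≥0∞)⁻¹) := by
    simp only [midMass, Finset.sum_add_distrib, ← Finset.mul_sum]
    congr 1
    · congr 1
      have : ∑ x : BitString n, ∑ y : Fin μ, ∑ i : Fin μ, ∑ c : Fin (n + 1),
          (if x = onePoint (P y) (P i) c then (1 : ℝ≥0∞) else 0) = μ * (μ * (n + 1)) := by
        rw [Finset.sum_comm]
        have : ∀ y : Fin μ, ∑ x : BitString n, ∑ i : Fin μ, ∑ c : Fin (n + 1),
          (if x = onePoint (P y) (P i) c then (1 : ℝ≥0∞) else 0) = μ * (n + 1) := by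
          intro y
          rw [Finset.sum_comm]
          have : ∀ i : Fin μ, ∑ x : BitString n, ∑ c : Fin (n + 1),
            (if x = onePoint (P y) (P i) c then (1 : ℝ≥0∞) else 0) = (n + 1) := by
            intro i
            rw [Finset.sum_comm]
            simp
          rw [Finset.sum_congr rfl fun i _ => this i]
          simp [mul_add]
        rw [Finset.sum_congr rfl fun i _ => this i]
        simp
      rw [this]
      ring
    · congr 1
      rw [Finset.sum_comm]
      simp
      ring
  rw [e]
  calc _ ≤ ENNReal.ofReal pc * (1 * 1 * 1) + ENNReal.ofReal (1 - pc) * 1 := by gcongr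
    _ = 1 := by
      rw [mul_one, mul_one, mul_one, mul_one, ← ENNReal.ofReal_add h0 (by linarith)]; simp

lemma mutProb_sum {n : ℕ} (x : BitString n) : ∑ y, mutProb n x y ≤ 1 := by
  set a : ℝ≥0∞ := (n : ℝ≥0∞)⁻¹ with ha
  rcases Nat.eq_zero_or_pos n with rfl | hn
  · simp [mutProb, hammingDist]
  have e : ∀ y, mutProb n x y = ∏ i, (if x i ≠ y i then a else 1 - a) := by
    intro y
    rw [Finset.prod_ite, Finset.prod_const, Finset.prod_const, mutProb]
    congr 2
    have := Finset.card_filter_add_card_filter_not (s := (Finset.univ : Finset (Fin n)))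
      (fun i => x i ≠ y i)
    simp only [Finset.card_univ, Fintype.card_fin] at this
    unfold hammingDist
    omega
  have ha1 : a ≤ 1 := by
    rw [ha, ENNReal.inv_le_one]; exact_mod_cast hn
  simp only [e]
  have := Finset.prod_univ_sum (fun _ : Fin n => (Finset.univ : Finset Bool))
    (fun i b => if x i ≠ b then a else 1 - a)
  rw [Fintype.piFinset_univ] at this
  rw [← this]
  apply le_of_eq
  apply Finset.prod_eq_one
  intro i _
  cases x i <;> simp [ha1, add_tsub_cancel_of_le, tsub_add_cancel_of_le]

lemma step_eq {n μ : ℕ} (pc : ℝ) (s : State n μ) (V : State n μ → ℝ≥0∞) :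
    ∑ s', trans n μ pc s s' * V s' = ∑ mid, midMass pc s.1 mid * ∑ y, mutProb n mid y *
      ∑ j ∈ removalSet royalRoad (Fin.snoc s.1 y : Fin (μ + 1) → BitString n),
        ((removalSet royalRoad (Fin.snoc s.1 y : Fin (μ + 1) → BitString n)).card : ℝ≥0∞)⁻¹ *
          V (removeAt s.1 y j, (s.2 || decide (y = allOnes n))) := by
  simp only [trans, Finset.sum_mul]
  rw [Finset.sum_comm]
  refine Finset.sum_congr rfl fun mid _ => ?_
  simp only [mul_assoc, ← Finset.mul_sum]
  congr 1
  simp only [Finset.sum_mul]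
  rw [Finset.sum_comm]
  refine Finset.sum_congr rfl fun y _ => ?_
  simp only [mul_assoc, ← Finset.mul_sum]
  congr 1
  simp only [Finset.sum_mul]
  rw [Finset.sum_comm]
  congr 1
  refine Finset.sum_congr rfl fun j _ => ?_
  rw [Finset.sum_eq_single (removeAt s.1 y j, (s.2 || decide (y = allOnes n)))]
  · simp
  · intro b _ hb
    rw [if_neg, zero_mul]
    rintro ⟨h1, h2⟩
    exact hb (Prod.ext h1 h2)
  · simp

lemma step_le {n μ : ℕ} (pc : ℝ) (h0 : 0 ≤ pc) (h1 : pc ≤ 1)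
    (s : State n μ) (V : State n μ → ℝ≥0∞) (v w : ℝ≥0∞) (z : BitString n)
    (hV1 : ∀ y, ∀ j ∈ removalSet royalRoad (Fin.snoc s.1 y : Fin (μ + 1) → BitString n),
      V (removeAt s.1 y j, (s.2 || decide (y = allOnes n))) ≤ v + w)
    (hV2 : ∀ j ∈ removalSet royalRoad (Fin.snoc s.1 z : Fin (μ + 1) → BitString n),
      V (removeAt s.1 z j, (s.2 || decide (z = allOnes n))) ≤ v)
    (hw : 1 ≤ (∑ mid, midMass pc s.1 mid * mutProb n mid z) * w) :
    ∑ s', trans n μ pc s s' * V s' + 1 ≤ v + w := by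
  rw [step_eq]
  have avg : ∀ (R : Finset (Fin (μ + 1))) (g : Fin (μ + 1) → ℝ≥0∞) (B : ℝ≥0∞),
      (∀ j ∈ R, g j ≤ B) → ∑ j ∈ R, (R.card : ℝ≥0∞)⁻¹ * g j ≤ B := by
    intro R g B h
    calc _ ≤ ∑ j ∈ R, (R.card : ℝ≥0∞)⁻¹ * B := by
          refine Finset.sum_le_sum fun j hj => ?_
          gcongr; exact h j hj
      _ = (R.card * (R.card : ℝ≥0∞)⁻¹) * B := by simp [mul_assoc]
      _ ≤ 1 * B := by gcongr; exact ENNReal.mul_inv_le_one _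
      _ = B := one_mul _
  set X : BitString n → ℝ≥0∞ := fun y =>
      ∑ j ∈ removalSet royalRoad (Fin.snoc s.1 y : Fin (μ + 1) → BitString n),
        ((removalSet royalRoad (Fin.snoc s.1 y : Fin (μ + 1) → BitString n)).card : ℝ≥0∞)⁻¹ *
          V (removeAt s.1 y j, (s.2 || decide (y = allOnes n))) with hX
  have hXy : ∀ y, X y + (if y = z then w else 0) ≤ v + w := by
    intro y
    split_ifs with h
    · subst h
      gcongr
      exact avg _ _ _ hV2
    · rw [add_zero]; exact avg _ _ _ (hV1 y)
  calc _ ≤ ∑ mid, midMass pc s.1 mid * ∑ y, mutProb n mid y * X y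
        + (∑ mid, midMass pc s.1 mid * mutProb n mid z) * w := by gcongr
    _ = ∑ mid, midMass pc s.1 mid * ∑ y, mutProb n mid y * (X y + if y = z then w else 0) := by
        rw [Finset.sum_mul, ← Finset.sum_add_distrib]
        refine Finset.sum_congr rfl fun mid _ => ?_
        rw [mul_assoc, ← mul_add]
        congr 1
        simp only [mul_add, Finset.sum_add_distrib]
        simp
    _ ≤ ∑ mid, midMass pc s.1 mid * ∑ y, mutProb n mid y * (v + w) := by
        refine Finset.sum_le_sum fun mid _ => mul_le_mul_right ?_ _
        exact Finset.sum_le_sum fun y _ => mul_le_mul_right (hXy y) _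
    _ ≤ ∑ mid, midMass pc s.1 mid * (1 * (v + w)) := by
        gcongr with mid _
        rw [← Finset.sum_mul]
        gcongr
        exact mutProb_sum _
    _ ≤ 1 * (1 * (v + w)) := by
        rw [← Finset.sum_mul]
        gcongr
        exact midMass_sum pc h0 h1 _
    _ = v + w := by simp

lemma le_maxBlock {n : ℕ} (x : BitString n) (s k : ℕ) (h : s + k ≤ n)
    (hx : ∀ j < k, xval x (s + j) = true) : k ≤ maxBlock x := by
  unfold maxBlock
  refine Finset.le_sup (f := id) (b := k) ?_
  rw [Finset.mem_filter, Finset.mem_range]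
  exact ⟨by omega, s, h, hx⟩

lemma maxBlock_spec {n : ℕ} (x : BitString n) :
    ∃ s, s + maxBlock x ≤ n ∧ ∀ j < maxBlock x, xval x (s + j) = true := by
  have hne : ((Finset.range (n + 1)).filter fun k =>
    ∃ s, s + k ≤ n ∧ ∀ j < k, xval x (s + j) = true).Nonempty :=
    ⟨0, by simp only [Finset.mem_filter, Finset.mem_range]; exact ⟨by omega, 0, by omega, by omega⟩⟩
  obtain ⟨k, hk, e⟩ := Finset.exists_mem_eq_sup _ hne id
  rw [Finset.mem_filter] at hk
  have : maxBlock x = k := e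
  rw [this]
  exact hk.2

lemma xval_val {n : ℕ} (x : BitString n) (i : Fin n) : xval x i.val = x i := by
  simp [xval]

lemma block_le_ones {n : ℕ} (x : BitString n) (s k : ℕ) (h : s + k ≤ n)
    (hx : ∀ j < k, xval x (s + j) = true) : k ≤ onesCount x := by
  have := Finset.card_le_card_of_injOn (s := (Finset.univ : Finset (Fin k)))
    (t := Finset.univ.filter fun i => x i = true)
    (fun j => (⟨s + j.val, by omega⟩ : Fin n))
    (by
      intro j _
      simp only [Finset.coe_filter, Finset.mem_univ, true_and, Set.mem_ofPred_eq]
      have h2 := hx j j.2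
      rw [← xval_val x]; exact h2)
    (by
      intro a _ b _ hab
      simp only [Fin.mk.injEq] at hab
      exact Fin.ext (by omega))
  simpa [onesCount] using this

lemma maxBlock_le_ones {n : ℕ} (x : BitString n) : maxBlock x ≤ onesCount x := by
  obtain ⟨s, h, hx⟩ := maxBlock_spec x
  exact block_le_ones x s _ h hx

lemma ones_le_of_subset {n : ℕ} (x : BitString n) (s b : ℕ)
    (h : ∀ i, x i = true → s ≤ i.val ∧ i.val < s + b) : onesCount x ≤ b := by
  have := Finset.card_le_card_of_injOn (s := Finset.univ.filter fun i => x i = true)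
    (t := Finset.Ico s (s + b)) (fun i => i.val)
    (by
      intro i hi
      simp only [Finset.coe_filter, Finset.mem_univ, true_and, Set.mem_ofPred_eq] at hi
      simp only [Finset.coe_Ico, Set.mem_Ico]
      exact h i hi)
    (by
      intro a _ b _ hab
      exact Fin.ext hab)
  simpa [onesCount] using this

lemma ones_update_true {n : ℕ} (x : BitString n) (q : Fin n) (h : x q = false) :
    onesCount (Function.update x q true) = onesCount x + 1 := by
  unfold onesCount
  rw [← Finset.card_insert_of_notMem (a := q) (s := Finset.univ.filter fun i => x i = true)
    (by simp [h])]
  congr 1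
  ext i
  by_cases hi : i = q
  · subst hi; simp
  · simp [hi]

lemma ones_update_false {n : ℕ} (x : BitString n) (p : Fin n) (h : x p = true) :
    onesCount (Function.update x p false) + 1 = onesCount x := by
  rw [← ones_update_true _ p (by simp)]
  congr 1
  rw [Function.update_idem, ← h, Function.update_eq_self]

lemma ones_allOnes (n : ℕ) : onesCount (allOnes n) = n := by
  simp [onesCount, allOnes]

lemma ne_allOnes {n : ℕ} (x : BitString n) (h : onesCount x < n) : x ≠ allOnes n := by
  rintro rfl
  rw [ones_allOnes] at h
  omega

lemma exists_false {n : ℕ} (x : BitString n) (h : onesCount x < n) : ∃ q, x q = false := by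
  by_contra hc
  push Not at hc
  apply ne_allOnes x h
  funext i
  have := hc i
  simp only [ne_eq, Bool.not_eq_false] at this
  simp [allOnes, this]

lemma ham_update {n : ℕ} (x : BitString n) (q : Fin n) (b : Bool) :
    hammingDist x (Function.update x q b) ≤ 1 := by
  unfold hammingDist
  rw [Finset.card_le_one]
  have : ∀ a, x a ≠ Function.update x q b a → a = q := by
    intro a ha
    by_contra hne
    simp [hne] at ha
  intro a ha c hc
  rw [Finset.mem_filter] at ha hc
  rw [this a ha.2, this c hc.2]

lemma R_of_le {n : ℕ} (x : BitString n) (h1 : x ≠ allOnes n) (h : onesCount x ≤ 2 * n / 3) :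
    royalRoad x = n * onesCount x + maxBlock x := by
  simp [royalRoad, h1, h]

lemma R_of_gt {n : ℕ} (x : BitString n) (h1 : x ≠ allOnes n) (h : ¬ onesCount x ≤ 2 * n / 3) :
    royalRoad x = 0 := by
  simp only [royalRoad, h1, h, if_false]

lemma R_le {n : ℕ} (m : ℕ) (hn : n = 3 * m) (x : BitString n) (h1 : x ≠ allOnes n) :
    royalRoad x ≤ n * (2 * m) + 2 * m := by
  by_cases h : onesCount x ≤ 2 * n / 3
  · rw [R_of_le x h1 h]
    have := maxBlock_le_ones x
    have h2 : onesCount x ≤ 2 * m := by omega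
    gcongr
    omega
  · rw [R_of_gt x h1 h]; omega

/-- block string -/
def blk (n m s : ℕ) : BitString n := fun i => decide (s ≤ i.val ∧ i.val < s + 2 * m)

lemma ones_blk {n : ℕ} (m : ℕ) (hn : n = 3 * m) (s : ℕ) (hs : s ≤ m) :
    onesCount (blk n m s) = 2 * m ∧ 2 * m ≤ maxBlock (blk n m s) := by
  have h1 : onesCount (blk n m s) ≤ 2 * m := by
    apply ones_le_of_subset _ s
    intro i hi
    simpa [blk] using hi
  have h2 : 2 * m ≤ maxBlock (blk n m s) := by
    apply le_maxBlock _ s _ (by omega)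
    intro j hj
    have : s + j < n := by omega
    simp [xval, this, blk, hj]
  have := maxBlock_le_ones (blk n m s)
  exact ⟨by omega, h2⟩

lemma R_blk {n : ℕ} (m : ℕ) (hm : 1 ≤ m) (hn : n = 3 * m) (s : ℕ) (hs : s ≤ m) :
    royalRoad (blk n m s) = n * (2 * m) + 2 * m ∧ blk n m s ≠ allOnes n := by
  obtain ⟨h1, h2⟩ := ones_blk m hn s hs
  have h3 := ne_allOnes (blk n m s) (by omega)
  refine ⟨?_, h3⟩
  have := maxBlock_le_ones (blk n m s)
  rw [R_of_le _ h3 (by omega), h1]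
  omega

lemma block_lt_ones {n : ℕ} (x : BitString n) (s k : ℕ) (h : s + k ≤ n)
    (hx : ∀ j < k, xval x (s + j) = true) (p : Fin n) (hp : x p = true)
    (hps : ¬ (s ≤ p.val ∧ p.val < s + k)) : k + 1 ≤ onesCount x := by
  rw [← ones_update_false x p hp]
  have := block_le_ones (Function.update x p false) s k h (by
    intro j hj
    have h1 : s + j < n := by omega
    have := hx j hj
    simp only [xval, h1, dif_pos] at this ⊢
    rw [Function.update_of_ne _ _ _, this]
    intro h
    rw [← h] at hps
    simp at hps
    omega)
  omega

lemma R_eq_top {n : ℕ} (m : ℕ) (hm : 1 ≤ m) (hn : n = 3 * m) (x : BitString n)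
    (h1 : x ≠ allOnes n) (h : royalRoad x = n * (2 * m) + 2 * m) :
    ∃ s ≤ m, x = blk n m s := by
  have hle : onesCount x ≤ 2 * n / 3 := by
    by_contra hc
    rw [R_of_gt x h1 hc] at h
    omega
  rw [R_of_le x h1 hle] at h
  have hb := maxBlock_le_ones x
  have ho : onesCount x = 2 * m := by
    by_contra hc
    have h2 : onesCount x + 1 ≤ 2 * m := by omega
    have h3 : n * (onesCount x + 1) ≤ n * (2 * m) := Nat.mul_le_mul_left _ h2
    rw [mul_add] at h3
    omega
  have hB : maxBlock x = 2 * m := by rw [ho] at h; omega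
  obtain ⟨s, hs, hx⟩ := maxBlock_spec x
  rw [hB] at hs hx
  refine ⟨s, by omega, ?_⟩
  funext i
  simp only [blk]
  by_cases hi : s ≤ i.val ∧ i.val < s + 2 * m
  · have := hx (i.val - s) (by omega)
    rw [show s + (i.val - s) = i.val by omega, xval_val] at this
    simp [this, hi]
  · have : x i = false := by
      by_contra hc
      have := block_lt_ones x s _ hs hx i (by simpa using hc) hi
      omega
    simp [this]
    omega

lemma target_A {n : ℕ} (m : ℕ) (hn : n = 3 * m) (x : BitString n)
    (h1 : x ≠ allOnes n) (h0 : 0 < royalRoad x) (h : royalRoad x < n * (2 * m)) :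
    ∃ z, hammingDist x z ≤ 1 ∧ z ≠ allOnes n ∧ royalRoad x < royalRoad z := by
  have hle : onesCount x ≤ 2 * n / 3 := by
    by_contra hc
    rw [R_of_gt x h1 hc] at h0
    omega
  have hR := R_of_le x h1 hle
  have hlt : onesCount x < 2 * m := by
    by_contra hc
    have : onesCount x = 2 * m := by omega
    rw [this] at hR
    omega
  obtain ⟨q, hq⟩ := exists_false x (by omega)
  have ho := ones_update_true x q hq
  have hz := ne_allOnes (Function.update x q true) (by omega)
  refine ⟨_, ham_update x q true, hz, ?_⟩
  rw [hR, R_of_le _ hz (by omega), ho, mul_add]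
  have := maxBlock_le_ones x
  omega

lemma target_B {n : ℕ} (m : ℕ) (hm : 1 ≤ m) (hn : n = 3 * m) (x : BitString n)
    (h1 : x ≠ allOnes n) (h0 : n * (2 * m) ≤ royalRoad x)
    (h : royalRoad x < n * (2 * m) + 2 * m) :
    ∃ z, hammingDist x z ≤ 2 ∧ z ≠ allOnes n ∧ royalRoad x < royalRoad z := by
  have hpos : 0 < n * (2 * m) := by subst hn; positivity
  have hle : onesCount x ≤ 2 * n / 3 := by
    by_contra hc
    rw [R_of_gt x h1 hc] at h0
    omega
  have hR := R_of_le x h1 hle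
  have hb := maxBlock_le_ones x
  have ho : onesCount x = 2 * m := by
    by_contra hc
    have h2 : onesCount x + 1 ≤ 2 * m := by omega
    have h3 : n * (onesCount x + 1) ≤ n * (2 * m) := Nat.mul_le_mul_left _ h2
    rw [mul_add] at h3
    omega
  obtain ⟨s, hs, hx⟩ := maxBlock_spec x
  set b := maxBlock x with hbdef
  have hblt : b < 2 * m := by rw [ho] at hR; omega
  obtain ⟨p, hp, hps⟩ : ∃ p, x p = true ∧ ¬ (s ≤ p.val ∧ p.val < s + b) := by
    by_contra hc
    push Not at hc
    have := ones_le_of_subset x s b (fun i hi => ⟨(hc i hi).1, (hc i hi).2⟩)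
    omega
  -- new block
  obtain ⟨q, s', hs', hq⟩ : ∃ (q : Fin n) (s' : ℕ), s' + (b + 1) ≤ n ∧
      ∀ j < b + 1, s' + j = q.val ∨ (s ≤ s' + j ∧ s' + j < s + b) := by
    by_cases hc : s + b < n
    · exact ⟨⟨s + b, hc⟩, s, by omega, fun j hj => by simp; omega⟩
    · exact ⟨⟨s - 1, by omega⟩, s - 1, by omega, fun j hj => by simp; omega⟩
  have hxin : ∀ i, s ≤ i → i < s + b → xval x i = true := by
    intro i hi hi2
    have := hx (i - s) (by omega)
    rwa [show s + (i - s) = i by omega] at this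
  have hqf : x q = false := by
    by_contra hc
    have hc : x q = true := by simpa using hc
    have := le_maxBlock x s' (b + 1) hs' (by
      intro j hj
      rcases hq j hj with h | h
      · rw [h, xval_val, hc]
      · exact hxin _ h.1 h.2)
    omega
  have hpq : q ≠ p := by
    rintro rfl; rw [hp] at hqf; simp at hqf
  have hpf := ones_update_false x p hp
  have hqt := ones_update_true (Function.update x p false) q (by rw [Function.update_of_ne hpq, hqf])
  set z := Function.update (Function.update x p false) q true with hz
  have hz1 := ne_allOnes z (by omega)
  refine ⟨z, ?_, hz1, ?_⟩
  · refine le_trans (hammingDist_triangle x (Function.update x p false) z) ?_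
    have := ham_update x p false
    have : hammingDist (Function.update x p false) z ≤ 1 := ham_update (Function.update x p false) q true
    omega
  · have hB : b + 1 ≤ maxBlock z := by
      apply le_maxBlock z s' (b + 1) hs'
      intro j hj
      by_cases hjq : s' + j = q.val
      · rw [hjq, xval_val, hz]; simp
      · rcases hq j hj with h | h
        · exact absurd h hjq
        · have h2 := hxin _ h.1 h.2
          have hl : s' + j < n := by omega
          simp only [xval, hl, dif_pos] at h2 ⊢
          rw [hz, Function.update_of_ne, Function.update_of_ne, h2]
          · intro e; rw [← e] at hps; exact hps h
          · intro e; rw [← e] at hjq; exact hjq rfl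
    rw [hR, R_of_le z hz1 (by omega), show onesCount z = onesCount x by omega]
    omega

lemma ham_blk (n m s : ℕ) : hammingDist (blk n m s) (blk n m (s + 1)) ≤ 2 := by
  unfold hammingDist
  have := Finset.card_le_card_of_injOn
    (s := Finset.univ.filter fun i => blk n m s i ≠ blk n m (s + 1) i)
    (t := {s, s + 2 * m}) (fun i => i.val)
    (by
      intro i hi
      simp only [Finset.coe_filter, Finset.mem_univ, true_and, Set.mem_ofPred_eq, blk, ne_eq,
        decide_eq_decide] at hi
      simp only [Finset.coe_insert, Finset.coe_singleton, Set.mem_insert_iff, Set.mem_singleton_iff]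
      omega)
    (by
      intro a _ b _ hab
      exact Fin.ext hab)
  exact le_trans this Finset.card_le_two

/-- from a proper nonempty set of types, find an adjacent pair. -/
lemma adj (m : ℕ) (A : ℕ → Prop) (s t : ℕ) (hs : s ≤ m) (ht : t ≤ m) (hA : A s) (hB : ¬ A t) :
    ∃ u, u + 1 ≤ m ∧ ((A u ∧ ¬ A (u + 1)) ∨ (¬ A u ∧ A (u + 1))) := by
  by_contra hc
  push Not at hc
  have : ∀ u ≤ m, A u ↔ A 0 := by
    intro u
    induction u with
    | zero => simp
    | succ u ih =>
      intro hu
      rw [← ih (by omega)]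
      have := hc u hu
      tauto
  rw [this s hs] at hA
  rw [this t ht] at hB
  exact hB hA

lemma mem_removal {n μ : ℕ} (f : BitString n → ℕ) (all : Fin (μ + 1) → BitString n)
    (j : Fin (μ + 1)) (h : j ∈ removalSet f all) :
    (∀ i', f (all j) ≤ f (all i')) ∧
      ∀ j', (∀ i', f (all j') ≤ f (all i')) → dup all j' ≤ dup all j := by
  simp only [removalSet, Finset.mem_filter, Finset.mem_univ, true_and] at h
  exact h

lemma removeAt_has {n μ : ℕ} (P : Fin μ → BitString n) (y : BitString n) (j a : Fin (μ + 1))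
    (h : a ≠ j) : ∃ i, removeAt P y j i = (Fin.snoc P y : Fin (μ + 1) → BitString n) a := by
  induction a using Fin.lastCases with
  | last =>
    have hj : j.val < μ := by
      have : j.val ≠ μ := fun e => h (Fin.ext (by simp [e]))
      omega
    refine ⟨⟨j.val, hj⟩, ?_⟩
    simp [removeAt, hj]
  | cast i =>
    refine ⟨i, ?_⟩
    rw [Fin.snoc_castSucc]
    unfold removeAt
    split_ifs with hj
    · rw [Function.update_of_ne]
      intro e
      apply h
      rw [e]
      exact Fin.ext rfl
    · rfl

lemma removeAt_mem {n μ : ℕ} (P : Fin μ → BitString n) (y : BitString n) (j : Fin (μ + 1))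
    (i : Fin μ) : removeAt P y j i = y ∨ removeAt P y j i = P i := by
  unfold removeAt
  split_ifs with hj
  · by_cases h : i = ⟨j.val, hj⟩
    · left; rw [h]; simp
    · right; rw [Function.update_of_ne h]
  · right; rfl

lemma mono_fit {n μ : ℕ} (hμ : 1 ≤ μ) (P : Fin μ → BitString n) (y : BitString n)
    (j : Fin (μ + 1))
    (hj : j ∈ removalSet royalRoad (Fin.snoc P y : Fin (μ + 1) → BitString n)) (a : Fin (μ + 1)) :
    ∃ i, royalRoad ((Fin.snoc P y : Fin (μ + 1) → BitString n) a)
      ≤ royalRoad (removeAt P y j i) := by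
  by_cases h : a = j
  · subst h
    have : Nontrivial (Fin (μ + 1)) := Fin.nontrivial_iff_two_le.2 (by omega)
    obtain ⟨a', ha'⟩ := exists_ne a
    obtain ⟨i, hi⟩ := removeAt_has P y a a' ha'
    exact ⟨i, by rw [hi]; exact (mem_removal _ _ _ hj).1 a'⟩
  · obtain ⟨i, hi⟩ := removeAt_has P y j a h
    exact ⟨i, by rw [hi]⟩

lemma mono_type {n μ : ℕ} (m : ℕ) (hm : 1 ≤ m) (hn : n = 3 * m) (hμ : 2 * m + 1 ≤ μ)
    (P : Fin μ → BitString n) (y : BitString n)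
    (hP : ∀ i, P i ≠ allOnes n) (hy : y ≠ allOnes n) (j : Fin (μ + 1))
    (hj : j ∈ removalSet royalRoad (Fin.snoc P y : Fin (μ + 1) → BitString n)) (a : Fin (μ + 1))
    (ha : royalRoad ((Fin.snoc P y : Fin (μ + 1) → BitString n) a) = n * (2 * m) + 2 * m) :
    ∃ i, removeAt P y j i = (Fin.snoc P y : Fin (μ + 1) → BitString n) a := by
  by_cases h : a = j
  · subst h
    obtain ⟨hw, hd⟩ := mem_removal _ _ _ hj
    set all : Fin (μ + 1) → BitString n := Fin.snoc P y with hall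
    have hne : ∀ b, all b ≠ allOnes n := by
      intro b
      induction b using Fin.lastCases with
      | last => simpa [hall] using hy
      | cast i => simpa [hall] using hP i
    have hF : ∀ b, royalRoad (all b) = n * (2 * m) + 2 * m := by
      intro b
      have h1 := R_le m hn (all b) (hne b)
      have h2 := hw b
      omega
    have hB : ∀ b, ∃ s : Fin (m + 1), all b = blk n m s := by
      intro b
      obtain ⟨s, hs, e⟩ := R_eq_top m hm hn (all b) (hne b) (hF b)
      exact ⟨⟨s, by omega⟩, e⟩
    choose g hg using hB
    obtain ⟨b, c, hbc, e⟩ := Fintype.exists_ne_map_eq_of_card_lt g (by simp; omega)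
    have hbc' : all b = all c := by rw [hg b, hg c, e]
    have hdb : 2 ≤ dup all b := by
      have : ({b, c} : Finset (Fin (μ + 1))) ⊆ Finset.univ.filter fun j' => all j' = all b := by
        intro x hx
        simp only [Finset.mem_insert, Finset.mem_singleton] at hx
        rcases hx with rfl | rfl <;> simp [hbc']
      have h2 := Finset.card_le_card this
      rw [Finset.card_pair hbc] at h2
      exact h2
    have hda := hd b (fun i' => by rw [hF, hF])
    have : 1 < (Finset.univ.filter fun j' => all j' = all a).card := by
      unfold dup at hda hdb
      omega
    obtain ⟨a', ha', hne'⟩ := Finset.exists_mem_ne this a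
    simp only [Finset.mem_filter, Finset.mem_univ, true_and] at ha'
    obtain ⟨i, hi⟩ := removeAt_has P y a a' hne'
    exact ⟨i, by rw [hi]; exact ha'⟩
  · exact removeAt_has P y j a h

/-- best fitness -/
def best {n μ : ℕ} (P : Fin μ → BitString n) : ℕ := Finset.univ.sup fun i => royalRoad (P i)

/-- the plateau optima present -/
def types {n μ : ℕ} (m : ℕ) (P : Fin μ → BitString n) : Finset (BitString n) :=
  (Finset.univ.image P).filter fun x => royalRoad x = n * (2 * m) + 2 * m

def lev {n μ : ℕ} (m : ℕ) (P : Fin μ → BitString n) : ℕ := best P + (types m P).card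

lemma best_mono {n μ : ℕ} (hμ : 1 ≤ μ) (P : Fin μ → BitString n) (y : BitString n)
    (j : Fin (μ + 1))
    (hj : j ∈ removalSet royalRoad (Fin.snoc P y : Fin (μ + 1) → BitString n)) :
    best P ≤ best (removeAt P y j) ∧ royalRoad y ≤ best (removeAt P y j) := by
  have key : ∀ a, royalRoad ((Fin.snoc P y : Fin (μ + 1) → BitString n) a)
      ≤ best (removeAt P y j) := by
    intro a
    obtain ⟨i, hi⟩ := mono_fit hμ P y j hj a
    exact hi.trans (Finset.le_sup (f := fun i => royalRoad (removeAt P y j i)) (Finset.mem_univ i))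
  constructor
  · apply Finset.sup_le
    intro i _
    have := key (Fin.castSucc i)
    simpa using this
  · simpa using key (Fin.last μ)

lemma types_mono {n μ : ℕ} (m : ℕ) (hm : 1 ≤ m) (hn : n = 3 * m) (hμ : 2 * m + 1 ≤ μ)
    (P : Fin μ → BitString n) (y : BitString n)
    (hP : ∀ i, P i ≠ allOnes n) (hy : y ≠ allOnes n) (j : Fin (μ + 1))
    (hj : j ∈ removalSet royalRoad (Fin.snoc P y : Fin (μ + 1) → BitString n)) :
    types m P ⊆ types m (removeAt P y j) ∧
      (royalRoad y = n * (2 * m) + 2 * m → y ∈ types m (removeAt P y j)) := by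
  have key := mono_type m hm hn hμ P y hP hy j hj
  constructor
  · intro x hx
    simp only [types, Finset.mem_filter, Finset.mem_image, Finset.mem_univ, true_and] at hx ⊢
    obtain ⟨⟨i, rfl⟩, h⟩ := hx
    refine ⟨?_, h⟩
    have := key (Fin.castSucc i)
    rw [Fin.snoc_castSucc] at this
    exact this h
  · intro h
    simp only [types, Finset.mem_filter, Finset.mem_image, Finset.mem_univ, true_and]
    refine ⟨?_, h⟩
    have := key (Fin.last μ)
    rw [Fin.snoc_last] at this
    exact this h

lemma lev_mono {n μ : ℕ} (m : ℕ) (hm : 1 ≤ m) (hn : n = 3 * m) (hμ : 2 * m + 1 ≤ μ)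
    (P : Fin μ → BitString n) (y : BitString n)
    (hP : ∀ i, P i ≠ allOnes n) (hy : y ≠ allOnes n) (j : Fin (μ + 1))
    (hj : j ∈ removalSet royalRoad (Fin.snoc P y : Fin (μ + 1) → BitString n)) :
    lev m P ≤ lev m (removeAt P y j) := by
  have h1 := (best_mono (by omega) P y j hj).1
  have h2 := Finset.card_le_card (types_mono m hm hn hμ P y hP hy j hj).1
  unfold lev
  omega

lemma lev_lt {n μ : ℕ} (m : ℕ) (hm : 1 ≤ m) (hn : n = 3 * m) (hμ : 2 * m + 1 ≤ μ)
    (P : Fin μ → BitString n) (y : BitString n)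
    (hP : ∀ i, P i ≠ allOnes n) (hy : y ≠ allOnes n)
    (h : best P < royalRoad y ∨ (royalRoad y = n * (2 * m) + 2 * m ∧ y ∉ types m P))
    (j : Fin (μ + 1))
    (hj : j ∈ removalSet royalRoad (Fin.snoc P y : Fin (μ + 1) → BitString n)) :
    lev m P + 1 ≤ lev m (removeAt P y j) := by
  obtain ⟨h1, h1'⟩ := (best_mono (by omega) P y j hj)
  obtain ⟨h2, h2'⟩ := types_mono m hm hn hμ P y hP hy j hj
  have h3 := Finset.card_le_card h2
  unfold lev
  rcases h with h | ⟨h, h'⟩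
  · omega
  · have : types m P ⊂ types m (removeAt P y j) :=
      Finset.ssubset_iff_subset_ne.2 ⟨h2, fun e => h' (e ▸ h2' h)⟩
    have := Finset.card_lt_card this
    omega

lemma best_le {n μ : ℕ} (m : ℕ) (hn : n = 3 * m) (P : Fin μ → BitString n)
    (hP : ∀ i, P i ≠ allOnes n) : best P ≤ n * (2 * m) + 2 * m :=
  Finset.sup_le fun i _ => R_le m hn _ (hP i)

lemma types_sub {n μ : ℕ} (m : ℕ) (hm : 1 ≤ m) (hn : n = 3 * m) (P : Fin μ → BitString n)
    (hP : ∀ i, P i ≠ allOnes n) :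
    types m P ⊆ (Finset.range (m + 1)).image (blk n m) := by
  intro x hx
  simp only [types, Finset.mem_filter, Finset.mem_image, Finset.mem_univ, true_and] at hx
  obtain ⟨⟨i, rfl⟩, h⟩ := hx
  obtain ⟨s, hs, e⟩ := R_eq_top m hm hn _ (hP i) h
  rw [e]
  exact Finset.mem_image_of_mem _ (Finset.mem_range.2 (by omega))

lemma lev_le {n μ : ℕ} (m : ℕ) (hm : 1 ≤ m) (hn : n = 3 * m) (P : Fin μ → BitString n)
    (hP : ∀ i, P i ≠ allOnes n) : lev m P ≤ n * (2 * m) + 2 * m + m + 1 := by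
  have h1 := best_le m hn P hP
  have h2 := Finset.card_le_card (types_sub m hm hn P hP)
  have h3 := (Finset.card_image_le (s := Finset.range (m + 1)) (f := blk n m))
  rw [Finset.card_range] at h3
  unfold lev
  omega

lemma best_spec {n μ : ℕ} (hμ : 1 ≤ μ) (P : Fin μ → BitString n) :
    ∃ i, best P = royalRoad (P i) := by
  have : (Finset.univ : Finset (Fin μ)).Nonempty := ⟨⟨0, by omega⟩, Finset.mem_univ _⟩
  obtain ⟨i, _, h⟩ := Finset.exists_mem_eq_sup _ this fun i => royalRoad (P i)
  exact ⟨i, h⟩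

/-- main case analysis -/
lemma target {n μ : ℕ} (m : ℕ) (hm : 1 ≤ m) (hn : n = 3 * m) (hμ : 2 * m + 1 ≤ μ)
    (P : Fin μ → BitString n) (hP : ∀ i, P i ≠ allOnes n) :
    lev m P = 0 ∨
    (0 < lev m P ∧ lev m P < n * (2 * m) ∧ ∃ i z, hammingDist (P i) z ≤ 1 ∧ z ≠ allOnes n ∧
      (best P < royalRoad z ∨ (royalRoad z = n * (2 * m) + 2 * m ∧ z ∉ types m P))) ∨
    (n * (2 * m) ≤ lev m P ∧ lev m P < n * (2 * m) + 2 * m + m + 1 ∧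
      ∃ i z, hammingDist (P i) z ≤ 2 ∧ z ≠ allOnes n ∧
      (best P < royalRoad z ∨ (royalRoad z = n * (2 * m) + 2 * m ∧ z ∉ types m P))) ∨
    (lev m P = n * (2 * m) + 2 * m + m + 1 ∧ (∃ i, P i = blk n m 0) ∧ ∃ i, P i = blk n m m) := by
  obtain ⟨i, hi⟩ := best_spec (by omega) P
  have hbl := best_le m hn P hP
  have hll := lev_le m hm hn P hP
  rcases hbl.lt_or_eq with hb | hb
  · have ht : types m P = ∅ := by
      rw [types, Finset.filter_eq_empty_iff]
      intro x hx
      simp only [Finset.mem_image, Finset.mem_univ, true_and] at hx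
      obtain ⟨i', rfl⟩ := hx
      have : royalRoad (P i') ≤ best P :=
        Finset.le_sup (f := fun i => royalRoad (P i)) (Finset.mem_univ i')
      omega
    have hl : lev m P = best P := by simp [lev, ht]
    by_cases h0 : best P = 0
    · left; omega
    right
    by_cases h1 : best P < n * (2 * m)
    · left
      refine ⟨by omega, by omega, i, ?_⟩
      obtain ⟨z, hz1, hz2, hz3⟩ := target_A m hn (P i) (hP i) (by omega) (by omega)
      exact ⟨z, hz1, hz2, Or.inl (by omega)⟩
    · right; left
      refine ⟨by omega, by omega, i, ?_⟩
      obtain ⟨z, hz1, hz2, hz3⟩ := target_B m hm hn (P i) (hP i) (by omega) (by omega)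
      exact ⟨z, hz1, hz2, Or.inl (by omega)⟩
  · right; right
    have hmem : ∀ s, blk n m s ∈ types m P → ∃ i, P i = blk n m s := by
      intro s hs
      simp only [types, Finset.mem_filter, Finset.mem_image, Finset.mem_univ, true_and] at hs
      exact hs.1
    by_cases hall : ∀ s ≤ m, blk n m s ∈ types m P
    · right
      refine ⟨?_, hmem _ (hall _ (by omega)), hmem _ (hall _ le_rfl)⟩
      have hinj : Set.InjOn (blk n m) (Finset.range (m + 1)) := by
        intro a ha b hb hab
        simp only [Finset.coe_range, Set.mem_Iio] at ha hb
        have h1 := congrFun hab ⟨a, by omega⟩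
        have h2 := congrFun hab ⟨b, by omega⟩
        simp only [blk, decide_eq_decide] at h1 h2
        omega
      have hsub : (Finset.range (m + 1)).image (blk n m) ⊆ types m P := by
        intro x hx
        rw [Finset.mem_image] at hx
        obtain ⟨s, hs, rfl⟩ := hx
        exact hall s (by rw [Finset.mem_range] at hs; omega)
      have := Finset.card_le_card hsub
      rw [Finset.card_image_of_injOn hinj, Finset.card_range] at this
      unfold lev at hll ⊢
      omega
    · left
      push Not at hall
      obtain ⟨t, ht, htn⟩ := hall
      obtain ⟨s, hs, he⟩ := R_eq_top m hm hn (P i) (hP i) (by omega)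
      have hsT : blk n m s ∈ types m P := by
        simp only [types, Finset.mem_filter, Finset.mem_image, Finset.mem_univ, true_and]
        exact ⟨⟨i, he⟩, (R_blk m hm hn s hs).1⟩
      have hlt : lev m P < n * (2 * m) + 2 * m + m + 1 := by
        have h1 : types m P ⊂ (Finset.range (m + 1)).image (blk n m) := by
          refine Finset.ssubset_iff_subset_ne.2 ⟨types_sub m hm hn P hP, fun e => htn ?_⟩
          rw [e]
          exact Finset.mem_image_of_mem _ (Finset.mem_range.2 (by omega))
        have h2 := Finset.card_lt_card h1
        have h3 := (Finset.card_image_le (s := Finset.range (m + 1)) (f := blk n m))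
        rw [Finset.card_range] at h3
        unfold lev
        omega
      refine ⟨by unfold lev; omega, hlt, ?_⟩
      obtain ⟨u, hu, h | h⟩ := adj m (fun s => blk n m s ∈ types m P) s t hs ht hsT htn
      · obtain ⟨i', hi'⟩ := hmem _ h.1
        have := R_blk m hm hn (u + 1) hu
        exact ⟨i', blk n m (u + 1), by rw [hi']; exact ham_blk n m u, this.2, Or.inr ⟨this.1, h.2⟩⟩
      · obtain ⟨i', hi'⟩ := hmem _ h.2
        have := R_blk m hm hn u (by omega)
        exact ⟨i', blk n m u, by rw [hi', hammingDist_comm]; exact ham_blk n m u, this.2,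
          Or.inr ⟨this.1, h.1⟩⟩

lemma single_mass {n μ : ℕ} (pc ε : ℝ) (h1 : ε ≤ 1 - pc) (P : Fin μ → BitString n) (i : Fin μ)
    (z : BitString n) :
    ENNReal.ofReal ε * (μ : ℝ≥0∞)⁻¹ * mutProb n (P i) z ≤
      ∑ mid, midMass pc P mid * mutProb n mid z := by
  have h := Finset.single_le_sum (f := fun mid => midMass pc P mid * mutProb n mid z)
    (fun _ _ => zero_le) (Finset.mem_univ (P i))
  refine le_trans ?_ h
  gcongr
  refine le_trans ?_ le_add_self
  gcongr
  have := Finset.single_le_sum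
    (f := fun i' : Fin μ => (μ : ℝ≥0∞)⁻¹ * (if P i = P i' then 1 else 0))
    (fun _ _ => zero_le) (Finset.mem_univ i)
  simpa using this

lemma cross_mass {n μ : ℕ} (m : ℕ) (hn : n = 3 * m) (pc : ℝ) (P : Fin μ → BitString n)
    (i₁ i₂ : Fin μ) (e₁ : P i₁ = blk n m 0) (e₂ : P i₂ = blk n m m) :
    ENNReal.ofReal pc * ((μ : ℝ≥0∞)⁻¹ * (μ : ℝ≥0∞)⁻¹) * (3 : ℝ≥0∞)⁻¹ *
      mutProb n (allOnes n) (allOnes n) ≤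
      ∑ mid, midMass pc P mid * mutProb n mid (allOnes n) := by
  have h := Finset.single_le_sum (f := fun mid => midMass pc P mid * mutProb n mid (allOnes n))
    (fun _ _ => zero_le) (Finset.mem_univ (allOnes n))
  refine le_trans ?_ h
  gcongr
  refine le_trans ?_ le_self_add
  rw [mul_assoc]
  gcongr
  have ha := Finset.single_le_sum
    (f := fun i₁ : Fin μ => ∑ i₂ : Fin μ, ((μ : ℝ≥0∞)⁻¹ * (μ : ℝ≥0∞)⁻¹) *
      ∑ c : Fin (n + 1), ((n : ℝ≥0∞) + 1)⁻¹ *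
        (if allOnes n = onePoint (P i₁) (P i₂) c then 1 else 0))
    (fun _ _ => zero_le) (Finset.mem_univ i₁)
  have hb := Finset.single_le_sum
    (f := fun i₂ : Fin μ => ((μ : ℝ≥0∞)⁻¹ * (μ : ℝ≥0∞)⁻¹) *
      ∑ c : Fin (n + 1), ((n : ℝ≥0∞) + 1)⁻¹ *
        (if allOnes n = onePoint (P i₁) (P i₂) c then 1 else 0))
    (fun _ _ => zero_le) (Finset.mem_univ i₂)
  refine le_trans ?_ (le_trans hb ha)
  gcongr
  rw [← Finset.mul_sum]
  have hc : (m : ℝ≥0∞) + 1 ≤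
      ∑ c : Fin (n + 1), (if allOnes n = onePoint (P i₁) (P i₂) c then (1 : ℝ≥0∞) else 0) := by
    have : ∀ c : Fin (n + 1), m ≤ c.val ∧ c.val ≤ 2 * m →
        allOnes n = onePoint (P i₁) (P i₂) c := by
      intro c hc
      funext i
      have := i.2
      simp only [allOnes, onePoint, e₁, e₂, blk]
      split_ifs
      · symm; rw [decide_eq_true_iff]; omega
      · symm; rw [decide_eq_true_iff]; omega
    rw [Finset.sum_boole]
    have h2 := Finset.card_le_card_of_injOn (s := (Finset.univ : Finset (Fin (m + 1))))
      (t := Finset.univ.filter fun c : Fin (n + 1) => allOnes n = onePoint (P i₁) (P i₂) c)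
      (fun t => (⟨m + t.val, by omega⟩ : Fin (n + 1)))
      (by
        intro t _
        simp only [Finset.coe_filter, Finset.mem_univ, true_and, Set.mem_ofPred_eq]
        exact this _ ⟨by simp, by simp; omega⟩)
      (by
        intro a _ b _ hab
        simp only [Fin.mk.injEq] at hab
        exact Fin.ext (by omega))
    rw [Finset.card_univ, Fintype.card_fin] at h2
    exact_mod_cast h2
  refine le_trans ?_ (mul_le_mul_right hc _)
  have h3 : ((n : ℝ≥0∞) + 1) ≤ 3 * (m + 1) := by
    subst hn
    norm_cast
    omega
  calc (3 : ℝ≥0∞)⁻¹ = (3 * ((m : ℝ≥0∞) + 1))⁻¹ * ((m : ℝ≥0∞) + 1) := by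
        rw [ENNReal.mul_inv (by simp) (by simp), mul_assoc, ENNReal.inv_mul_cancel (by simp)
          (by finiteness), mul_one]
    _ ≤ _ := by gcongr

lemma pow_bound (n : ℕ) (hn : 3 ≤ n) : (16 : ℝ≥0∞)⁻¹ ≤ (1 - (n : ℝ≥0∞)⁻¹) ^ n := by
  have hn' : (3 : ℝ) ≤ n := by exact_mod_cast hn
  have hr : (1 / 16 : ℝ) ≤ (1 - (n : ℝ)⁻¹) ^ n := by
    have hi : (n : ℝ)⁻¹ ≤ 1 / 3 := by
      rw [inv_le_comm₀ (by linarith) (by norm_num)]; norm_num; exact hn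
    have hi0 : 0 < (n : ℝ)⁻¹ := by positivity
    set k := (n + 1) / 2 with hk
    have hB := one_add_mul_le_pow (a := -(n : ℝ)⁻¹) (by linarith) k
    have hk2 : (k : ℝ) ≤ (n + 1) / 2 := by
      have : 2 * k ≤ n + 1 := by omega
      have : (2 * k : ℝ) ≤ n + 1 := by exact_mod_cast this
      linarith
    have h4 : (1 / 4 : ℝ) ≤ (1 - (n : ℝ)⁻¹) ^ k := by
      rw [sub_eq_add_neg]
      refine le_trans ?_ hB
      have : (k : ℝ) * (n : ℝ)⁻¹ ≤ (n + 1) / 2 * (n : ℝ)⁻¹ := by gcongr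
      have h5 : ((n : ℝ) + 1) / 2 * (n : ℝ)⁻¹ = 1 / 2 + (n : ℝ)⁻¹ / 2 := by
        field_simp
      linarith
    calc (1 / 16 : ℝ) = 1 / 4 * (1 / 4) := by norm_num
      _ ≤ (1 - (n : ℝ)⁻¹) ^ k * (1 - (n : ℝ)⁻¹) ^ k := by gcongr
      _ = (1 - (n : ℝ)⁻¹) ^ (k + k) := by rw [pow_add]
      _ ≤ _ := pow_le_pow_of_le_one (by linarith) (by linarith) (by omega)
  have e : (1 - (n : ℝ≥0∞)⁻¹) = ENNReal.ofReal (1 - (n : ℝ)⁻¹) := by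
    rw [ENNReal.ofReal_sub _ (by positivity), ENNReal.ofReal_one,
      ENNReal.ofReal_inv_of_pos (by linarith), ENNReal.ofReal_natCast]
  have h1 : 0 ≤ 1 - (n : ℝ)⁻¹ := by
    have : (n : ℝ)⁻¹ ≤ 1 := inv_le_one_of_one_le₀ (by linarith)
    linarith
  rw [e, ← ENNReal.ofReal_pow h1]
  refine le_trans (le_of_eq ?_) (ENNReal.ofReal_le_ofReal hr)
  rw [one_div, ENNReal.ofReal_inv_of_pos (by norm_num)]
  norm_num

lemma inv_n_le (n : ℕ) (hn : 1 ≤ n) : (n : ℝ≥0∞)⁻¹ ≤ 1 := by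
  rw [ENNReal.inv_le_one]; exact_mod_cast hn

lemma mut_lower {n : ℕ} (hn : 3 ≤ n) (x z : BitString n) (d : ℕ) (h : hammingDist x z ≤ d) :
    ((n : ℝ≥0∞)⁻¹) ^ d * (16 : ℝ≥0∞)⁻¹ ≤ mutProb n x z := by
  unfold mutProb
  refine mul_le_mul' (pow_le_pow_of_le_one zero_le (inv_n_le n (by omega)) h) ?_
  exact (pow_bound n hn).trans (pow_le_pow_of_le_one zero_le tsub_le_self (by omega))

lemma mut_lower' {n : ℕ} (hn : 3 ≤ n) (x z : BitString n) :
    ((n : ℝ≥0∞)⁻¹) ^ n ≤ mutProb n x z := by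
  unfold mutProb
  have hd : hammingDist x z ≤ n := by simpa using hammingDist_le_card_fintype (x := x) (y := z)
  have : (n : ℝ≥0∞)⁻¹ ≤ 1 - (n : ℝ≥0∞)⁻¹ := by
    apply ENNReal.le_sub_of_add_le_left (by simp; omega)
    rw [← ENNReal.inv_two_add_inv_two]
    have : (n : ℝ≥0∞)⁻¹ ≤ 2⁻¹ := by
      rw [ENNReal.inv_le_inv]; exact_mod_cast (by omega : 2 ≤ n)
    gcongr
  calc ((n : ℝ≥0∞)⁻¹) ^ n = ((n : ℝ≥0∞)⁻¹) ^ hammingDist x z *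
        ((n : ℝ≥0∞)⁻¹) ^ (n - hammingDist x z) := by
        rw [← pow_add]; congr 1; omega
    _ ≤ _ := by gcongr

/-- waiting time bounds -/
def wt (n m μ : ℕ) (ε pc : ℝ) (l : ℕ) : ℝ≥0∞ :=
  if l = 0 then (ENNReal.ofReal ε)⁻¹ * μ * (n : ℝ≥0∞) ^ n
  else if l < n * (2 * m) then (ENNReal.ofReal ε)⁻¹ * μ * ((n : ℝ≥0∞) ^ 1 * 16)
  else if l < n * (2 * m) + 2 * m + m + 1 then (ENNReal.ofReal ε)⁻¹ * μ * ((n : ℝ≥0∞) ^ 2 * 16)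
  else (ENNReal.ofReal pc)⁻¹ * (μ * μ) * 3 * 16

def pot (n m μ : ℕ) (ε pc : ℝ) (s : State n μ) : ℝ≥0∞ :=
  if s.2 = true then 0 else if ∃ i, s.1 i = allOnes n then ⊤ else
    ∑ l ∈ Finset.Ico (lev m s.1) (n * (2 * m) + 2 * m + m + 2), wt n m μ ε pc l

lemma cancel_aux (a b c : ℝ≥0∞) (ha : a ≠ 0) (ha' : a ≠ ⊤) (hb : b ≠ 0) (hb' : b ≠ ⊤)
    (hc : c ≠ 0) (hc' : c ≠ ⊤) : (1 : ℝ≥0∞) ≤ a * b⁻¹ * c⁻¹ * (a⁻¹ * b * c) := by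
  apply le_of_eq
  calc (1 : ℝ≥0∞) = (a * a⁻¹) * (b⁻¹ * b) * (c⁻¹ * c) := by
        rw [ENNReal.mul_inv_cancel ha ha', ENNReal.inv_mul_cancel hb hb',
          ENNReal.inv_mul_cancel hc hc']; simp
    _ = _ := by ring

lemma pot_drift (n m μ : ℕ) (ε pc : ℝ) (hm : 1 ≤ m) (hn : n = 3 * m) (hμ : 2 * m + 1 ≤ μ)
    (hε : 0 < ε) (hpc : 0 < pc) (hpc1 : pc ≤ 1 - ε) (s : State n μ) :
    ∑ s', trans n μ pc s s' * pot n m μ ε pc s' + (if ¬ s.2 = true then 1 else 0)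
      ≤ pot n m μ ε pc s := by
  obtain ⟨P, b⟩ := s
  cases b with
  | true =>
    rw [step_eq]
    simp [pot]
  | false =>
    by_cases hP : ∃ i, P i = allOnes n
    · simp [pot, hP]
    push Not at hP
    have hpot : ∀ Q : Fin μ → BitString n, (∀ i, Q i ≠ allOnes n) → pot n m μ ε pc (Q, false) =
        ∑ l ∈ Finset.Ico (lev m Q) (n * (2 * m) + 2 * m + m + 2), wt n m μ ε pc l := by
      intro Q hQ
      simp [pot, hQ]
    have hll := lev_le m hm hn P hP
    have hsplit : pot n m μ ε pc (P, false) =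
        ∑ l ∈ Finset.Ico (lev m P + 1) (n * (2 * m) + 2 * m + m + 2), wt n m μ ε pc l
          + wt n m μ ε pc (lev m P) := by
      rw [hpot P hP, Finset.sum_eq_sum_Ico_succ_bot (by omega), add_comm]
    have hmonopot : ∀ y j, j ∈ removalSet royalRoad (Fin.snoc P y : Fin (μ + 1) → BitString n) →
        ∀ k, (y ≠ allOnes n → k ≤ lev m (removeAt P y j)) →
        pot n m μ ε pc (removeAt P y j, (false || decide (y = allOnes n))) ≤
          ∑ l ∈ Finset.Ico k (n * (2 * m) + 2 * m + m + 2), wt n m μ ε pc l := by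
      intro y j hj k hk
      by_cases hy : y = allOnes n
      · simp [pot, hy]
      · have e : (false || decide (y = allOnes n)) = false := by simp [hy]
        rw [e, hpot]
        · exact Finset.sum_le_sum_of_subset (Finset.Ico_subset_Ico_left (hk hy))
        · intro i
          rcases removeAt_mem P y j i with h | h <;> rw [h]
          · exact hy
          · exact hP i
    have main : ∀ z, (z ≠ allOnes n → (best P < royalRoad z ∨
          (royalRoad z = n * (2 * m) + 2 * m ∧ z ∉ types m P))) →
        1 ≤ (∑ mid, midMass pc P mid * mutProb n mid z) * wt n m μ ε pc (lev m P) →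
        ∑ s', trans n μ pc (P, false) s' * pot n m μ ε pc s' + 1 ≤ pot n m μ ε pc (P, false) := by
      intro z hz hw
      rw [hsplit]
      apply step_le pc hpc.le (by linarith) (P, false) _ _ _ z
      · intro y j hj
        rw [← hsplit, hpot P hP]
        exact hmonopot y j hj _ fun hy => lev_mono m hm hn hμ P y hP hy j hj
      · intro j hj
        exact hmonopot z j hj _ fun hy => lev_lt m hm hn hμ P z hP hy (hz hy) j hj
      · exact hw
    simp only [Bool.false_eq_true, not_false_eq_true, if_true]
    have hε0 : ENNReal.ofReal ε ≠ 0 := by simpa using hε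
    have hp0 : ENNReal.ofReal pc ≠ 0 := by simpa using hpc
    have hμ0 : (μ : ℝ≥0∞) ≠ 0 := by simp; omega
    have hn0 : (n : ℝ≥0∞) ≠ 0 := by simp; omega
    rcases target m hm hn hμ P hP with h | ⟨h0, h, i, z, hd, hz, hb⟩ | ⟨h0, h, i, z, hd, hz, hb⟩ |
      ⟨h, ⟨i₁, h1⟩, ⟨i₂, h2⟩⟩
    · apply main (allOnes n) (fun h => absurd rfl h)
      have i : Fin μ := ⟨0, by omega⟩
      refine le_trans ?_ (mul_le_mul_left (single_mass pc ε (by linarith) P i _) _)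
      refine le_trans ?_ (mul_le_mul_left (mul_le_mul_right (mut_lower' (by omega) _ _) _) _)
      rw [h, wt, if_pos rfl, ← ENNReal.inv_pow]
      exact cancel_aux _ _ _ hε0 (by finiteness) hμ0 (by finiteness) (pow_ne_zero _ hn0)
        (by finiteness)
    · apply main z (fun _ => hb)
      refine le_trans ?_ (mul_le_mul_left (single_mass pc ε (by linarith) P i _) _)
      refine le_trans ?_ (mul_le_mul_left (mul_le_mul_right (mut_lower (by omega) _ _ _ hd) _) _)
      rw [wt, if_neg (by omega), if_pos h, ← ENNReal.inv_pow,
        ← ENNReal.mul_inv (by simp) (by simp)]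
      exact cancel_aux _ _ _ hε0 (by finiteness) hμ0 (by finiteness)
        (mul_ne_zero (pow_ne_zero _ hn0) (by simp)) (by finiteness)
    · apply main z (fun _ => hb)
      have : 0 < n * (2 * m) := by subst hn; positivity
      refine le_trans ?_ (mul_le_mul_left (single_mass pc ε (by linarith) P i _) _)
      refine le_trans ?_ (mul_le_mul_left (mul_le_mul_right (mut_lower (by omega) _ _ _ hd) _) _)
      rw [wt, if_neg (by omega), if_neg (by omega), if_pos h, ← ENNReal.inv_pow,
        ← ENNReal.mul_inv (by simp) (by simp)]
      exact cancel_aux _ _ _ hε0 (by finiteness) hμ0 (by finiteness)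
        (mul_ne_zero (pow_ne_zero _ hn0) (by simp)) (by finiteness)
    · apply main (allOnes n) (fun h => absurd rfl h)
      have : 0 < n * (2 * m) := by subst hn; positivity
      refine le_trans ?_ (mul_le_mul_left (cross_mass m hn pc P i₁ i₂ h1 h2) _)
      refine le_trans ?_ (mul_le_mul_left (mul_le_mul_right
        (mut_lower (by omega) _ _ 0 (by simp)) _) _)
      rw [h, wt, if_neg (by omega), if_neg (by omega), if_neg (by omega), pow_zero, one_mul,
        ← ENNReal.mul_inv (by simp [hμ0]) (by simp)]
      have := cancel_aux (ENNReal.ofReal pc) (μ * μ) (3 * 16) hp0 (by finiteness)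
        (mul_ne_zero hμ0 hμ0) (by finiteness) (by norm_num) (by finiteness)
      refine this.trans (le_of_eq ?_)
      rw [ENNReal.mul_inv (a := 3) (by simp) (by simp)]
      ring

/-- zero-fitness strings -/
def bad (n : ℕ) : Finset (BitString n) :=
  Finset.univ.filter fun x => royalRoad x = 0 ∧ x ≠ allOnes n

lemma sum_two_pow (n : ℕ) : ∑ x : BitString n, 2 ^ onesCount x = 3 ^ n := by
  have e : ∀ x : BitString n, 2 ^ onesCount x = ∏ i, (if x i = true then 2 else 1) := by
    intro x
    rw [Finset.prod_ite, Finset.prod_const, Finset.prod_const_one, mul_one, onesCount]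
  simp only [e]
  have := Finset.prod_univ_sum (fun _ : Fin n => (Finset.univ : Finset Bool))
    (fun _ b => if b = true then 2 else 1)
  rw [Fintype.piFinset_univ] at this
  rw [← this]
  simp

lemma bad_card (n m : ℕ) (hm : 1 ≤ m) (hn : n = 3 * m) :
    (bad n).card * 4 ^ m ≤ 2 * 27 ^ m := by
  have hx : ∀ x ∈ bad n, 4 ^ m ≤ 2 ^ onesCount x + (if x = allZeros n then 4 ^ m else 0) := by
    intro x hx
    simp only [bad, Finset.mem_filter, Finset.mem_univ, true_and] at hx
    by_cases h : onesCount x ≤ 2 * n / 3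
    · rw [R_of_le x hx.2 h] at hx
      have : n * onesCount x = 0 := by omega
      have h0 : onesCount x = 0 := by
        rcases Nat.mul_eq_zero.1 this with h | h <;> omega
      have : x = allZeros n := by
        funext i
        simp only [onesCount, Finset.card_eq_zero, Finset.filter_eq_empty_iff] at h0
        have := h0 (Finset.mem_univ i)
        simpa [allZeros] using this
      rw [if_pos this]
      exact Nat.le_add_left _ _
    · calc 4 ^ m = 2 ^ (2 * m) := by rw [pow_mul]; norm_num
        _ ≤ 2 ^ onesCount x := Nat.pow_le_pow_right (by norm_num) (by omega)
        _ ≤ _ := Nat.le_add_right _ _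
  calc (bad n).card * 4 ^ m = ∑ x ∈ bad n, 4 ^ m := by simp
    _ ≤ ∑ x ∈ bad n, (2 ^ onesCount x + (if x = allZeros n then 4 ^ m else 0)) :=
        Finset.sum_le_sum hx
    _ ≤ ∑ x : BitString n, (2 ^ onesCount x + (if x = allZeros n then 4 ^ m else 0)) :=
        Finset.sum_le_sum_of_subset (Finset.subset_univ _)
    _ = 27 ^ m + 4 ^ m := by
        rw [Finset.sum_add_distrib, sum_two_pow, hn, pow_mul]
        simp
    _ ≤ 27 ^ m + 27 ^ m := by gcongr; norm_num
    _ = _ := by ring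

lemma ev_bound : ∃ M : ℕ, ∀ m ≥ M, 2 * (27 / 32 : ℝ) ^ m ≤ 1 ∧
    (3 * m : ℝ) ^ 3 * (2 * (27 / 32 : ℝ) ^ m) ^ 2 ≤ 1 := by
  have h1 := tendsto_pow_const_mul_const_pow_of_abs_lt_one 0 (r := (27 / 32 : ℝ))
    (by rw [abs_of_pos] <;> norm_num)
  have h2 := tendsto_pow_const_mul_const_pow_of_abs_lt_one 3 (r := (27 / 32 : ℝ) ^ 2)
    (by rw [abs_of_pos] <;> norm_num)
  have e1 := h1.eventually (gt_mem_nhds (show (0 : ℝ) < 1 / 2 by norm_num))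
  have e2 := h2.eventually (gt_mem_nhds (show (0 : ℝ) < 1 / 108 by norm_num))
  obtain ⟨M, hM⟩ := eventually_atTop.1 (e1.and e2)
  refine ⟨M, fun m hm => ?_⟩
  obtain ⟨a, b⟩ := hM m hm
  rw [pow_zero, one_mul] at a
  refine ⟨by linarith, ?_⟩
  rw [← pow_mul, mul_comm 2 m, pow_mul] at b
  nlinarith

lemma bad_bound (n m μ : ℕ) (hm : 1 ≤ m) (hn : n = 3 * m) (hμ : 2 * m + 1 ≤ μ)
    (h1 : 2 * (27 / 32 : ℝ) ^ m ≤ 1)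
    (h2 : (3 * m : ℝ) ^ 3 * (2 * (27 / 32 : ℝ) ^ m) ^ 2 ≤ 1) :
    (bad n).card ^ μ * n ^ n ≤ 2 ^ (n * μ) := by
  have hb : ((bad n).card : ℝ) * 4 ^ m ≤ 2 * 27 ^ m := by exact_mod_cast bad_card n m hm hn
  set r : ℝ := 2 * (27 / 32 : ℝ) ^ m with hr
  have hr0 : 0 ≤ r := by positivity
  have hbr : ((bad n).card : ℝ) ≤ r * 2 ^ n := by
    have e : r * 2 ^ n * 4 ^ m = 2 * 27 ^ m := by
      rw [hr, hn, pow_mul, mul_assoc, mul_assoc, ← mul_pow, ← mul_pow]; norm_num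
    have h4 : (0 : ℝ) < 4 ^ m := by positivity
    exact le_of_mul_le_mul_right (by rw [e]; exact hb) h4
  have : ((bad n).card : ℝ) ^ μ * (n : ℝ) ^ n ≤ 2 ^ (n * μ) := by
    calc ((bad n).card : ℝ) ^ μ * (n : ℝ) ^ n ≤ (r * 2 ^ n) ^ μ * (n : ℝ) ^ n := by gcongr
      _ = (r ^ μ * (n : ℝ) ^ n) * 2 ^ (n * μ) := by rw [mul_pow, pow_mul]; ring
      _ ≤ (r ^ (2 * m) * (n : ℝ) ^ n) * 2 ^ (n * μ) := by
          gcongr ?_ * _ * _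
          exact pow_le_pow_of_le_one hr0 h1 (by omega)
      _ = ((3 * m : ℝ) ^ 3 * r ^ 2) ^ m * 2 ^ (n * μ) := by
          congr 1
          rw [hn, pow_mul, pow_mul, ← mul_pow, mul_comm]
          push_cast
          rfl
      _ ≤ 1 ^ m * 2 ^ (n * μ) := by gcongr
      _ = _ := by simp
  exact_mod_cast this

lemma init_pot (n m μ : ℕ) (ε pc : ℝ) (W : ℝ≥0∞)
    (hW : ∑ l ∈ Finset.Ico 1 (n * (2 * m) + 2 * m + m + 2), wt n m μ ε pc l ≤ W) :
    ∑ s, init n μ s * pot n m μ ε pc s ≤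
      W + ((2 : ℝ≥0∞) ^ (n * μ))⁻¹ * (((bad n).card : ℝ≥0∞) ^ μ * wt n m μ ε pc 0) := by
  rw [Fintype.sum_prod_type]
  have hP : ∀ P : Fin μ → BitString n, ∑ b, init n μ (P, b) * pot n m μ ε pc (P, b) ≤
      ((2 : ℝ≥0∞) ^ (n * μ))⁻¹ * (W + if P ∈ Fintype.piFinset (fun _ : Fin μ => bad n)
        then wt n m μ ε pc 0 else 0) := by
    intro P
    rw [Fintype.sum_bool]
    by_cases h : ∃ i, P i = allOnes n
    · simp [init, pot, h]
    · have e : ∑ l ∈ Finset.Ico (lev m P) (n * (2 * m) + 2 * m + m + 2), wt n m μ ε pc l ≤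
          W + if P ∈ Fintype.piFinset (fun _ : Fin μ => bad n) then wt n m μ ε pc 0 else 0 := by
        by_cases hl : lev m P = 0
        · have hbad : P ∈ Fintype.piFinset (fun _ : Fin μ => bad n) := by
            rw [Fintype.mem_piFinset]
            intro i
            simp only [bad, Finset.mem_filter, Finset.mem_univ, true_and]
            have h1 : royalRoad (P i) ≤ best P :=
              Finset.le_sup (f := fun i => royalRoad (P i)) (Finset.mem_univ i)
            have h2 : best P = 0 := by unfold lev at hl; omega
            exact ⟨by omega, fun h' => h ⟨i, h'⟩⟩
          rw [if_pos hbad, hl, Finset.sum_eq_sum_Ico_succ_bot (by omega), add_comm]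
          gcongr
        · refine le_trans ?_ le_self_add
          refine le_trans ?_ hW
          exact Finset.sum_le_sum_of_subset (Finset.Ico_subset_Ico_left (by omega))
      have e1 : init n μ (P, true) = 0 := by simp [init, h]
      have e2 : init n μ (P, false) = ((2 : ℝ≥0∞) ^ (n * μ))⁻¹ := by simp [init, h]
      have e3 : pot n m μ ε pc (P, false) =
          ∑ l ∈ Finset.Ico (lev m P) (n * (2 * m) + 2 * m + m + 2), wt n m μ ε pc l := by
        simp [pot, h]
      rw [e1, e2, e3, zero_mul, zero_add]
      gcongr
  refine (Finset.sum_le_sum fun P _ => hP P).trans ?_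
  rw [← Finset.mul_sum, Finset.sum_add_distrib, mul_add]
  have c1 : ((2 : ℝ≥0∞) ^ (n * μ))⁻¹ * ∑ _P : Fin μ → BitString n, W ≤ W := by
    rw [Finset.sum_const, Finset.card_univ, nsmul_eq_mul, ← mul_assoc]
    have : ((Fintype.card (Fin μ → BitString n) : ℕ) : ℝ≥0∞) = 2 ^ (n * μ) := by
      simp [pow_mul]
    rw [this, ENNReal.inv_mul_cancel (by simp) (by finiteness), one_mul]
  have c2 : ∑ P : Fin μ → BitString n, (if P ∈ Fintype.piFinset (fun _ : Fin μ => bad n)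
        then wt n m μ ε pc 0 else 0) = ((bad n).card : ℝ≥0∞) ^ μ * wt n m μ ε pc 0 := by
    rw [Finset.sum_ite_mem, Finset.univ_inter, Finset.sum_const, Fintype.card_piFinset_const,
      nsmul_eq_mul]
    push_cast
    rfl
  rw [c2]
  gcongr

lemma wt_sum (n m μ : ℕ) (ε pc : ℝ) (hm : 1 ≤ m) (hn : n = 3 * m) (hε : 0 < ε) (hpc : 0 < pc) :
    ∑ l ∈ Finset.Ico 1 (n * (2 * m) + 2 * m + m + 2), wt n m μ ε pc l ≤
      ENNReal.ofReal (48 / ε * (μ * n ^ 3) + 48 * (μ ^ 2 / pc)) := by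
  have hpos : 0 < n * (2 * m) := by subst hn; positivity
  rw [← Finset.sum_Ico_consecutive _ (show 1 ≤ n * (2 * m) by omega)
      (show n * (2 * m) ≤ n * (2 * m) + 2 * m + m + 2 by omega),
    ← Finset.sum_Ico_consecutive _ (show n * (2 * m) ≤ n * (2 * m) + 2 * m + m + 1 by omega)
      (show n * (2 * m) + 2 * m + m + 1 ≤ n * (2 * m) + 2 * m + m + 2 by omega)]
  have eε : (ENNReal.ofReal ε)⁻¹ = ENNReal.ofReal ε⁻¹ := (ENNReal.ofReal_inv_of_pos hε).symm
  have ep : (ENNReal.ofReal pc)⁻¹ = ENNReal.ofReal pc⁻¹ := (ENNReal.ofReal_inv_of_pos hpc).symm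
  have eμ : (μ : ℝ≥0∞) = ENNReal.ofReal μ := by simp
  have en : (n : ℝ≥0∞) = ENNReal.ofReal n := by simp
  have e16 : (16 : ℝ≥0∞) = ENNReal.ofReal 16 := by simp
  have e3 : (3 : ℝ≥0∞) = ENNReal.ofReal 3 := by simp
  have hmn : (2 * m : ℝ) ≤ n := by exact_mod_cast (by omega : 2 * m ≤ n)
  have hmn' : (3 * m + 1 : ℝ) ≤ 2 * n := by exact_mod_cast (by omega : 3 * m + 1 ≤ 2 * n)
  have s1 : ∑ l ∈ Finset.Ico 1 (n * (2 * m)), wt n m μ ε pc l ≤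
      ENNReal.ofReal (16 / ε * (μ * n ^ 3)) := by
    rw [Finset.sum_congr rfl (g := fun _ => (ENNReal.ofReal ε)⁻¹ * μ * ((n : ℝ≥0∞) ^ 1 * 16))
      (by
        intro l hl
        rw [Finset.mem_Ico] at hl
        rw [wt, if_neg (by omega), if_pos hl.2])]
    rw [Finset.sum_const, Nat.card_Ico, nsmul_eq_mul]
    calc _ ≤ ((n * (2 * m) : ℕ) : ℝ≥0∞) * ((ENNReal.ofReal ε)⁻¹ * μ * ((n : ℝ≥0∞) ^ 1 * 16)) := by
          gcongr; omega
      _ = ENNReal.ofReal (((n * (2 * m) : ℕ) : ℝ) * (ε⁻¹ * μ * ((n : ℝ) ^ 1 * 16))) := by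
          rw [eε, eμ, en, e16, ← ENNReal.ofReal_pow (by positivity),
            ← ENNReal.ofReal_mul (by positivity), ← ENNReal.ofReal_mul (by positivity),
            ← ENNReal.ofReal_mul (by positivity), ← ENNReal.ofReal_natCast (n * (2 * m)),
            ← ENNReal.ofReal_mul (by positivity)]
      _ ≤ _ := by
          apply ENNReal.ofReal_le_ofReal
          push_cast
          calc (n : ℝ) * (2 * m) * (ε⁻¹ * μ * ((n : ℝ) ^ 1 * 16))
              ≤ (n : ℝ) * n * (ε⁻¹ * μ * ((n : ℝ) ^ 1 * 16)) := by gcongr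
            _ = _ := by ring
  have s2 : ∑ l ∈ Finset.Ico (n * (2 * m)) (n * (2 * m) + 2 * m + m + 1), wt n m μ ε pc l ≤
      ENNReal.ofReal (32 / ε * (μ * n ^ 3)) := by
    rw [Finset.sum_congr rfl (g := fun _ => (ENNReal.ofReal ε)⁻¹ * μ * ((n : ℝ≥0∞) ^ 2 * 16))
      (by
        intro l hl
        rw [Finset.mem_Ico] at hl
        rw [wt, if_neg (by omega), if_neg (by omega), if_pos hl.2])]
    rw [Finset.sum_const, Nat.card_Ico, nsmul_eq_mul,
      show n * (2 * m) + 2 * m + m + 1 - n * (2 * m) = 3 * m + 1 by omega]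
    calc _ = ENNReal.ofReal (((3 * m + 1 : ℕ) : ℝ) * (ε⁻¹ * μ * ((n : ℝ) ^ 2 * 16))) := by
          rw [eε, eμ, en, e16, ← ENNReal.ofReal_pow (by positivity),
            ← ENNReal.ofReal_mul (by positivity), ← ENNReal.ofReal_mul (by positivity),
            ← ENNReal.ofReal_mul (by positivity), ← ENNReal.ofReal_natCast (3 * m + 1),
            ← ENNReal.ofReal_mul (by positivity)]
      _ ≤ _ := by
          apply ENNReal.ofReal_le_ofReal
          push_cast
          calc (3 * m + 1 : ℝ) * (ε⁻¹ * μ * ((n : ℝ) ^ 2 * 16))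
              ≤ (2 * n : ℝ) * (ε⁻¹ * μ * ((n : ℝ) ^ 2 * 16)) := by gcongr
            _ = _ := by ring
  have s3 : ∑ l ∈ Finset.Ico (n * (2 * m) + 2 * m + m + 1) (n * (2 * m) + 2 * m + m + 2),
      wt n m μ ε pc l ≤ ENNReal.ofReal (48 * (μ ^ 2 / pc)) := by
    rw [Finset.sum_congr rfl (g := fun _ => (ENNReal.ofReal pc)⁻¹ * (μ * μ) * 3 * 16)
      (by
        intro l hl
        rw [Finset.mem_Ico] at hl
        rw [wt, if_neg (by omega), if_neg (by omega), if_neg (by omega)])]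
    rw [Finset.sum_const, Nat.card_Ico, nsmul_eq_mul,
      show n * (2 * m) + 2 * m + m + 2 - (n * (2 * m) + 2 * m + m + 1) = 1 by omega,
      Nat.cast_one, one_mul, ep, eμ, e3, e16, ← ENNReal.ofReal_mul (by positivity),
      ← ENNReal.ofReal_mul (by positivity), ← ENNReal.ofReal_mul (by positivity),
      ← ENNReal.ofReal_mul (by positivity)]
    apply le_of_eq
    congr 1
    ring
  calc _ ≤ ENNReal.ofReal (16 / ε * (μ * n ^ 3)) + (ENNReal.ofReal (32 / ε * (μ * n ^ 3)) +
        ENNReal.ofReal (48 * (μ ^ 2 / pc))) := by gcongr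
    _ = _ := by
      rw [← ENNReal.ofReal_add (by positivity) (by positivity),
        ← ENNReal.ofReal_add (by positivity) (by positivity)]
      congr 1
      ring

lemma final_bound (n m μ : ℕ) (ε pc : ℝ) (hm : 1 ≤ m) (hn : n = 3 * m) (hμ : 2 * m + 1 ≤ μ)
    (hε : 0 < ε) (hpc : 0 < pc) (hpc1 : pc ≤ 1 - ε)
    (h1 : 2 * (27 / 32 : ℝ) ^ m ≤ 1)
    (h2 : (3 * m : ℝ) ^ 3 * (2 * (27 / 32 : ℝ) ^ m) ^ 2 ≤ 1) :
    expOpt n μ pc ≤ ENNReal.ofReal ((49 / ε + 48) * (μ * n ^ 3 + μ ^ 2 / pc)) := by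
  have hd := drift (init n μ) (trans n μ pc) (fun s => ¬ s.2 = true) (pot n m μ ε pc)
    (fun s => by
      have := pot_drift n m μ ε pc hm hn hμ hε hpc hpc1 s
      convert this)
  have hi := init_pot n m μ ε pc _ (wt_sum n m μ ε pc hm hn hε hpc)
  refine hd.trans (hi.trans ?_)
  have hz : ((2 : ℝ≥0∞) ^ (n * μ))⁻¹ * (((bad n).card : ℝ≥0∞) ^ μ * wt n m μ ε pc 0) ≤
      ENNReal.ofReal (ε⁻¹ * μ) := by
    have hb : ((bad n).card : ℝ≥0∞) ^ μ * (n : ℝ≥0∞) ^ n ≤ 2 ^ (n * μ) := by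
      exact_mod_cast bad_bound n m μ hm hn hμ h1 h2
    rw [wt, if_pos rfl]
    calc _ = ((2 : ℝ≥0∞) ^ (n * μ))⁻¹ * (((bad n).card : ℝ≥0∞) ^ μ * (n : ℝ≥0∞) ^ n) *
          ((ENNReal.ofReal ε)⁻¹ * μ) := by ring
      _ ≤ ((2 : ℝ≥0∞) ^ (n * μ))⁻¹ * 2 ^ (n * μ) * ((ENNReal.ofReal ε)⁻¹ * μ) := by gcongr
      _ = _ := by
        rw [ENNReal.inv_mul_cancel (by simp) (by finiteness), one_mul,
          ENNReal.ofReal_mul (by positivity), ENNReal.ofReal_inv_of_pos hε, ENNReal.ofReal_natCast]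
  refine (add_le_add le_rfl hz).trans ?_
  rw [← ENNReal.ofReal_add (by positivity) (by positivity)]
  apply ENNReal.ofReal_le_ofReal
  have hn1 : (1 : ℝ) ≤ (n : ℝ) ^ 3 := one_le_pow₀ (by exact_mod_cast (by omega : 1 ≤ n))
  have a1 : ε⁻¹ * μ ≤ 1 / ε * (μ * (n : ℝ) ^ 3) := by
    calc ε⁻¹ * μ = 1 / ε * (μ * 1) := by simp
      _ ≤ _ := by gcongr
  have a2 : 0 ≤ 48 * (μ * (n : ℝ) ^ 3) := by positivity
  have a3 : 0 ≤ 49 / ε * (μ ^ 2 / pc) := by positivity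
  have : (49 / ε + 48) * (μ * (n : ℝ) ^ 3 + μ ^ 2 / pc) =
    48 / ε * (μ * n ^ 3) + 48 * (μ ^ 2 / pc) + 1 / ε * (μ * (n : ℝ) ^ 3) +
      48 * (μ * (n : ℝ) ^ 3) + 49 / ε * (μ ^ 2 / pc) := by ring
  linarith

/-- simplified from Theorem 3 in Jansen–Wegener: for 0 < ε < 1,
crossover probability p_c ≤ 1 − ε and population size μ ≥ 2n/3 + 1, the expected
optimization time of the (μ+1) GA with one-point crossover and duplicate-based
tie-breaking on the real royal road function Rₙ is O(μn³ + (μ log μ)n + μ²/p_c); in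
particular it is O(n⁴) if p_c is a positive constant and μ = O(n). -/
theorem muPlusOneGA_realRoyalRoad
    (ε : ℝ) (hε : 0 < ε ∧ ε < 1) (pc : ℕ → ℝ)
    (hpc : ∀ n, 0 < pc n ∧ pc n ≤ 1 - ε)
    (μ : ℕ → ℕ) (hμ : ∀ n, 2 * n / 3 + 1 ≤ μ n) :
    (∃ C : ℝ, 0 < C ∧ ∀ᶠ n : ℕ in atTop, 3 ∣ n →
      expOpt n (μ n) (pc n) ≤
        ENNReal.ofReal (C * ((μ n : ℝ) * n ^ 3 + ((μ n : ℝ) * Real.log (μ n)) * n +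
          (μ n : ℝ) ^ 2 / pc n))) ∧
    ∀ pc₀ : ℝ, 0 < pc₀ → (∀ n, pc n = pc₀) →
      ∀ κ : ℝ, (∀ n, (μ n : ℝ) ≤ κ * n) →
        ∃ C : ℝ, 0 < C ∧ ∀ᶠ n : ℕ in atTop, 3 ∣ n →
          expOpt n (μ n) (pc n) ≤ ENNReal.ofReal (C * (n : ℝ) ^ 4) := by
  have key : ∀ᶠ n : ℕ in atTop, 3 ∣ n → expOpt n (μ n) (pc n) ≤
      ENNReal.ofReal ((49 / ε + 48) * (μ n * n ^ 3 + μ n ^ 2 / pc n)) := by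
    obtain ⟨M, hM⟩ := ev_bound
    filter_upwards [eventually_ge_atTop (3 * M + 3)] with n hn h3
    obtain ⟨m, hm⟩ := h3
    obtain ⟨a, b⟩ := hM m (by omega)
    have := hμ n
    exact final_bound n m (μ n) ε (pc n) (by omega) hm (by omega) hε.1 (hpc n).1 (hpc n).2 a b
  have hε0 := hε.1
  constructor
  · refine ⟨49 / ε + 48, by positivity, ?_⟩
    filter_upwards [key] with n hn h3
    refine (hn h3).trans (ENNReal.ofReal_le_ofReal ?_)
    have h1 : (0 : ℝ) ≤ ((μ n : ℝ) * Real.log (μ n)) * n :=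
      mul_nonneg (mul_nonneg (by positivity) (Real.log_natCast_nonneg _)) (by positivity)
    gcongr
    linarith
  · intro pc₀ hp0 hpe κ hκ
    have hκ0 : 0 < κ := by
      have h1 := hκ 1
      have h2 : (1 : ℝ) ≤ μ 1 := by exact_mod_cast (by have := hμ 1; omega : 1 ≤ μ 1)
      simp only [Nat.cast_one, mul_one] at h1
      linarith
    refine ⟨(49 / ε + 48) * (κ + κ ^ 2 / pc₀), by positivity, ?_⟩
    filter_upwards [key, eventually_ge_atTop 1] with n hn hn1 h3
    refine (hn h3).trans (ENNReal.ofReal_le_ofReal ?_)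
    rw [hpe n, mul_assoc]
    have hk := hκ n
    have hn1' : (1 : ℝ) ≤ n := by exact_mod_cast hn1
    gcongr
    calc (μ n : ℝ) * n ^ 3 + μ n ^ 2 / pc₀ ≤ κ * n * n ^ 3 + (κ * n) ^ 2 / pc₀ := by gcongr
      _ = κ * n ^ 4 + κ ^ 2 / pc₀ * n ^ 2 := by ring
      _ ≤ κ * n ^ 4 + κ ^ 2 / pc₀ * n ^ 4 := by
        gcongr
        norm_num
      _ = _ := by ring

end Stmt14
end
end

section
/- The expected optimization time of the (1+1) EA for the Ising model on a ring with an even number n of vertices (equivalently, the 2-coloring problem on this ring) is O(n³), and when the algorithm is started from a coloring consisting of two monochromatic blocks of lengths εn and (1−ε)n for a constant 0 < ε < 1/2, the expected optimization time is Θ(n³). -/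
open Filter
open scoped ENNReal BigOperators Classical

noncomputable section

namespace Stmt15

/-- fitness of a coloring of the ring Cₙ: the number of monochromatic edges
(edges {i, i+1 mod n} whose endpoints have the same color) -/
def isingFit {n : ℕ} (x : BitString n) : ℕ :=
  (Finset.univ.filter fun i : Fin n =>
    x i = x ⟨(i.val + 1) % n, Nat.mod_lt _ i.pos⟩).card

/-- the global optima are the two constant colorings -/
def isOpt {n : ℕ} (x : BitString n) : Prop := x = allZeros n ∨ x = allOnes n

/-- State of a run: the current search point together with a flag recording whether a
global optimum has been created. -/
abbrev State (n : ℕ) := BitString n × Bool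

/-- One generation of the (1+1) EA: mutate the current search point and keep the
offspring if its fitness is not smaller. -/
def trans (n : ℕ) : State n → State n → ℝ≥0∞ := fun s s' =>
  ∑ y : BitString n, mutProb n s.1 y *
    (if s'.1 = (if isingFit s.1 ≤ isingFit y then y else s.1) ∧
        s'.2 = (s.2 || decide (isOpt y))
      then 1 else 0)

/-- uniform random initialization -/
def initU (n : ℕ) : State n → ℝ≥0∞ := fun s =>
  ((2 : ℝ≥0∞) ^ n)⁻¹ * (if s.2 = decide (isOpt s.1) then 1 else 0)

/-- deterministic initialization at the search point `x` -/
def initAt {n : ℕ} (x : BitString n) : State n → ℝ≥0∞ := fun s =>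
  if s = (x, decide (isOpt x)) then 1 else 0

/-- expected number of generations until a global optimum is first created -/
def expOpt {n : ℕ} (init : State n → ℝ≥0∞) : ℝ≥0∞ :=
  ∑' T : ℕ, probOf (evolve init (trans n) T) fun s => ¬ s.2 = true

/-- a coloring consisting of two monochromatic blocks of lengths ⌊εn⌋ and n − ⌊εn⌋ -/
def blockInit (n : ℕ) (ε : ℝ) : BitString n := fun i => decide (i.val < ⌊ε * n⌋₊)


/-! ### basic combinatorics -/

def Dd {n : ℕ} [NeZero n] (x : BitString n) (i : Fin n) : ℝ := if x i = x (i + 1) then 0 else 1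

def qq {n : ℕ} [NeZero n] (x : BitString n) (i : Fin n) : ℝ := 1 - Dd x (i - 1) - Dd x i

def dd {n : ℕ} [NeZero n] (x : BitString n) : ℝ := ∑ i, Dd x i

def sg {n : ℕ} (x : BitString n) (i : Fin n) : ℝ := if x i then 1 else -1

def mag {n : ℕ} (x : BitString n) : ℝ := ∑ i, sg x i

def flp {n : ℕ} (x : BitString n) (M : Finset (Fin n)) : BitString n :=
  fun i => if i ∈ M then !(x i) else x i

def mm {n : ℕ} (M : Finset (Fin n)) (i : Fin n) : ℝ := if i ∈ M then 1 else 0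

lemma Dd_cases {n : ℕ} [NeZero n] (x : BitString n) (i : Fin n) : Dd x i = 0 ∨ Dd x i = 1 := by
  unfold Dd; split_ifs <;> simp

lemma qq_cases {n : ℕ} [NeZero n] (x : BitString n) (i : Fin n) :
    qq x i = 1 ∨ qq x i = 0 ∨ qq x i = -1 := by
  unfold qq
  rcases Dd_cases x i with h | h <;> rcases Dd_cases x (i-1) with h' | h' <;> rw [h, h'] <;> norm_num

lemma sum_shift {n : ℕ} [NeZero n] (f : Fin n → ℝ) : ∑ i, f (i + 1) = ∑ i, f i :=
  Equiv.sum_comp (Equiv.addRight (1 : Fin n)) f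

lemma sum_shift' {n : ℕ} [NeZero n] (f : Fin n → ℝ) : ∑ i, f (i - 1) = ∑ i, f i :=
  Equiv.sum_comp (Equiv.subRight (1 : Fin n)) f

lemma Dd_flp {n : ℕ} [NeZero n] (x : BitString n) (M : Finset (Fin n)) (i : Fin n) :
    Dd (flp x M) i = Dd x i + (1 - 2 * Dd x i) * (mm M i + mm M (i+1) - 2 * mm M i * mm M (i+1)) := by
  unfold Dd flp mm
  by_cases h1 : i ∈ M <;> by_cases h2 : i + 1 ∈ M <;>
    rcases hx : x i <;> rcases hy : x (i+1) <;> simp [h1, h2] <;> norm_num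

lemma dd_flp {n : ℕ} [NeZero n] (x : BitString n) (M : Finset (Fin n)) :
    dd (flp x M) = dd x + 2 * ∑ i, mm M i * qq x i
      - 2 * ∑ i, (1 - 2 * Dd x i) * (mm M i * mm M (i+1)) := by
  unfold dd
  have h := sum_shift (fun i => (1 - 2 * Dd x (i-1)) * mm M i)
  simp only [add_sub_cancel_right] at h
  have h2 : ∑ i, Dd (flp x M) i = ∑ i, Dd x i + ∑ i, (1 - 2 * Dd x i) * mm M i
      + ∑ i, (1 - 2 * Dd x i) * mm M (i+1) - 2 * ∑ i, (1 - 2 * Dd x i) * (mm M i * mm M (i+1)) := by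
    rw [Finset.mul_sum, ← Finset.sum_add_distrib, ← Finset.sum_add_distrib, ← Finset.sum_sub_distrib]
    exact Finset.sum_congr rfl fun i _ => by rw [Dd_flp]; ring
  rw [h2, h, add_assoc (∑ i, Dd x i), ← Finset.sum_add_distrib, Finset.mul_sum (f := fun i => mm M i * qq x i)]
  congr 2
  exact Finset.sum_congr rfl fun i _ => by unfold qq; ring

lemma mag_flp {n : ℕ} (x : BitString n) (M : Finset (Fin n)) :
    mag (flp x M) = mag x - 2 * ∑ i, mm M i * sg x i := by
  unfold mag
  rw [Finset.mul_sum, ← Finset.sum_sub_distrib]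
  refine Finset.sum_congr rfl fun i _ => ?_
  unfold sg flp mm
  by_cases h1 : i ∈ M <;> rcases hx : x i <;> simp [h1, hx] <;> norm_num

lemma dd_nonneg {n : ℕ} [NeZero n] (x : BitString n) : 0 ≤ dd x :=
  Finset.sum_nonneg fun i _ => by rcases Dd_cases x i with h | h <;> rw [h] <;> norm_num

lemma dd_le {n : ℕ} [NeZero n] (x : BitString n) : dd x ≤ n := by
  calc dd x ≤ ∑ i : Fin n, (1:ℝ) :=
        Finset.sum_le_sum fun i _ => by rcases Dd_cases x i with h | h <;> rw [h] <;> norm_num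
    _ = n := by simp

lemma fit_dd {n : ℕ} [NeZero n] (x : BitString n) : (isingFit x : ℝ) = n - dd x := by
  have h0 : ∀ i : Fin n, (⟨(i.val + 1) % n, Nat.mod_lt _ i.pos⟩ : Fin n) = i + 1 := by
    intro i
    ext
    simp [Fin.val_add]
  unfold isingFit dd Dd
  simp only [h0]
  rw [Finset.card_filter]
  push_cast
  rw [eq_sub_iff_add_eq, ← Finset.sum_add_distrib]
  calc _ = ∑ i : Fin n, (1:ℝ) := Finset.sum_congr rfl fun i _ => by split_ifs <;> norm_num
    _ = n := by simp

lemma fit_le_iff {n : ℕ} [NeZero n] (x y : BitString n) :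
    isingFit x ≤ isingFit y ↔ dd y ≤ dd x := by
  rw [← Nat.cast_le (α := ℝ), fit_dd, fit_dd]
  constructor <;> intro h <;> linarith

lemma fin_closed {n : ℕ} [NeZero n] (p : Fin n → Prop) (i : Fin n) (hi : p i)
    (h : ∀ j, p j → p (j + 1)) : ∀ j, p j := by
  have h1 : ∀ k : ℕ, p (i + Fin.ofNat n k) := by
    intro k
    induction k with
    | zero =>
      have h0 : i + Fin.ofNat n 0 = i := by ext; simp [Fin.val_add, Nat.mod_eq_of_lt i.isLt]
      rw [h0]; exact hi
    | succ k ih =>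
      have := h _ ih
      have h0 : i + Fin.ofNat n (k + 1) = i + Fin.ofNat n k + 1 := by
        ext; simp [Fin.val_add, add_assoc]
      rw [h0]; exact this
  intro j
  have := h1 (j - i).val
  have h0 : i + Fin.ofNat n (j - i).val = j := by simp
  rwa [h0] at this

lemma Dd_zero_of_dd {n : ℕ} [NeZero n] (x : BitString n) (h : dd x = 0) (i : Fin n) : Dd x i = 0 := by
  unfold dd at h
  rw [Finset.sum_eq_zero_iff_of_nonneg] at h
  · exact h i (Finset.mem_univ _)
  · intro i _; rcases Dd_cases x i with h | h <;> rw [h] <;> norm_num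

lemma isOpt_iff {n : ℕ} [NeZero n] (x : BitString n) : isOpt x ↔ dd x = 0 := by
  constructor
  · rintro (h | h) <;> subst h <;> simp [dd, Dd, allZeros, allOnes]
  · intro h
    have h1 := fin_closed (fun i => x i = x 0) 0 rfl (by
      intro j hj
      have := Dd_zero_of_dd x h j
      unfold Dd at this
      split_ifs at this with h3
      · rw [← h3]; exact hj
      · norm_num at this)
    rcases h0 : x 0 with _ | _
    · left; funext i; rw [h1, h0]; rfl
    · right; funext i; rw [h1, h0]; rfl

lemma one_le_dd {n : ℕ} [NeZero n] (x : BitString n) (h : ¬ isOpt x) : 1 ≤ dd x := by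
  rw [isOpt_iff] at h
  have : ∃ i, Dd x i ≠ 0 := by
    by_contra hc
    push Not at hc
    exact h (Finset.sum_eq_zero fun i _ => hc i)
  obtain ⟨i, hi⟩ := this
  have h1 : Dd x i = 1 := (Dd_cases x i).resolve_left hi
  rw [← h1]
  exact Finset.single_le_sum (f := fun i => Dd x i) (fun j _ => by rcases Dd_cases x j with h | h <;> simp [h]) (Finset.mem_univ i)

lemma abs_sg {n : ℕ} (x : BitString n) (i : Fin n) : |sg x i| = 1 := by
  unfold sg; split_ifs <;> simp

lemma abs_mag {n : ℕ} (x : BitString n) : |mag x| ≤ n := by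
  calc |mag x| ≤ ∑ i, |sg x i| := Finset.abs_sum_le_sum_abs _ _
    _ = n := by simp [abs_sg]

lemma mag_opt {n : ℕ} (x : BitString n) (h : isOpt x) : |mag x| = n := by
  rcases h with h | h <;> subst h <;> simp [mag, sg, allZeros, allOnes]

lemma mm_cases {n : ℕ} (M : Finset (Fin n)) (i : Fin n) : mm M i = 0 ∨ mm M i = 1 := by
  unfold mm; split_ifs <;> simp

lemma mm_nonneg {n : ℕ} (M : Finset (Fin n)) (i : Fin n) : 0 ≤ mm M i := by
  rcases mm_cases M i with h | h <;> simp [h]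

lemma mm_one {n : ℕ} {M : Finset (Fin n)} {i : Fin n} : mm M i = 1 ↔ i ∈ M := by
  unfold mm; split_ifs with h <;> simp [h]

lemma mm_zero {n : ℕ} {M : Finset (Fin n)} {i : Fin n} : mm M i = 0 ↔ i ∉ M := by
  unfold mm; split_ifs with h <;> simp [h]

lemma acc_interior {n : ℕ} [NeZero n] (x : BitString n) (M : Finset (Fin n)) (hx : ¬ isOpt x)
    (hacc : dd (flp x M) ≤ dd x) (i : Fin n) (hi : i ∈ M) (hq : qq x i = 1) :
    ∃ j ∈ M, qq x j = -1 ∨ (qq x j = 0 ∧ (j + 1 ∈ M ∨ j - 1 ∈ M)) := by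
  by_contra hc
  push Not at hc
  rw [dd_flp] at hacc
  have key : ∀ j, j ∈ M → j + 1 ∈ M → qq x j = 1 ∧ Dd x j = 0 := by
    intro j h1 h2
    have h3 := hc j h1
    have h4 : qq x j = 1 := by
      rcases qq_cases x j with h | h | h
      · exact h
      · exact absurd h2 (h3.2 h).1
      · exact absurd h h3.1
    refine ⟨h4, ?_⟩
    unfold qq at h4
    rcases Dd_cases x j with h | h <;> rcases Dd_cases x (j-1) with h' | h' <;> linarith
  have hle : ∀ j ∈ Finset.univ, (1 - 2 * Dd x j) * (mm M j * mm M (j+1)) ≤ mm M j * qq x j := by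
    intro j _
    by_cases h1 : j ∈ M
    · rw [mm_one.2 h1]
      by_cases h2 : j + 1 ∈ M
      · rw [mm_one.2 h2, (key j h1 h2).1, (key j h1 h2).2]; norm_num
      · rw [mm_zero.2 h2]
        rcases qq_cases x j with h | h | h
        · rw [h]; norm_num
        · rw [h]; norm_num
        · exact absurd h (hc j h1).1
    · rw [mm_zero.2 h1]; norm_num
  have heq := (Finset.sum_eq_sum_iff_of_le hle).1 (le_antisymm (Finset.sum_le_sum hle) (by linarith))
  have hall := fin_closed (fun j => j ∈ M ∧ qq x j = 1) i ⟨hi, hq⟩ (by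
    rintro j ⟨h1, h2⟩
    have h3 := heq j (Finset.mem_univ _)
    rw [mm_one.2 h1, h2] at h3
    have h4 : j + 1 ∈ M := by
      by_contra h4
      rw [mm_zero.2 h4] at h3
      norm_num at h3
    refine ⟨h4, ?_⟩
    have h5 := hc _ h4
    rcases qq_cases x (j+1) with h | h | h
    · exact h
    · have := (h5.2 h).2
      simp at this
      exact absurd h1 this
    · exact absurd h h5.1)
  apply hx
  rw [isOpt_iff]
  exact Finset.sum_eq_zero fun j _ => (key j (hall j).1 (hall (j+1)).1).2

lemma dd_flp_single {n : ℕ} [NeZero n] (hn : 2 ≤ n) (x : BitString n) (i : Fin n) :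
    dd (flp x {i}) = dd x + 2 * qq x i := by
  rw [dd_flp]
  have h1 : ∑ j, mm {i} j * qq x j = qq x i := by
    simp [mm]
  have h2 : ∑ j, (1 - 2 * Dd x j) * (mm {i} j * mm {i} (j+1)) = 0 := by
    refine Finset.sum_eq_zero fun j _ => ?_
    have : j ≠ j + 1 := by
      have h3 : n ≠ 1 := by omega
      simp [h3]
    by_cases h : j = i
    · have h' : j + 1 ≠ i := fun h' => this (h.trans h'.symm)
      simp [mm, h']
    · simp [mm, h]
  rw [h1, h2]; ring

lemma flp_insert {n : ℕ} (x : BitString n) (M : Finset (Fin n)) (i : Fin n) (hi : i ∉ M) :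
    flp x (insert i M) = flp (flp x M) {i} := by
  funext j
  unfold flp
  by_cases h : j = i
  · subst h; simp [hi]
  · simp [h]

lemma dd_insert {n : ℕ} [NeZero n] (hn : 2 ≤ n) (x : BitString n) (M : Finset (Fin n)) (i : Fin n)
    (hi : i ∉ M) (hi1 : i + 1 ∉ M) (hi2 : i - 1 ∉ M) (hq : qq x i = 0) :
    dd (flp x (insert i M)) = dd (flp x M) := by
  rw [flp_insert x M i hi, dd_flp_single hn]
  have : qq (flp x M) i = qq x i := by
    unfold qq
    rw [Dd_flp, Dd_flp]
    simp [mm_zero.2 hi, mm_zero.2 hi1, mm_zero.2 hi2]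
  rw [this, hq]; ring

/-! ### mutation probabilities -/

def PP (n : ℕ) (M : Finset (Fin n)) : ℝ := (1 / (n:ℝ)) ^ M.card * (1 - 1 / (n:ℝ)) ^ (n - M.card)

lemma inv_n_nonneg (n : ℕ) : 0 ≤ 1 - 1 / (n:ℝ) := by
  rcases Nat.eq_zero_or_pos n with h | h
  · subst h; simp
  · have : (1:ℝ) ≤ n := by exact_mod_cast h
    rw [sub_nonneg, div_le_one (by linarith)]; exact this

lemma PP_nonneg (n : ℕ) (M : Finset (Fin n)) : 0 ≤ PP n M := by
  unfold PP
  have := inv_n_nonneg n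
  positivity

lemma PP_subset (n : ℕ) (S : Finset (Fin n)) :
    ∑ M : Finset (Fin n), PP n M * (if S ⊆ M then 1 else 0) = (1 / (n:ℝ)) ^ S.card := by
  have h1 : ∑ M : Finset (Fin n), PP n M * (if S ⊆ M then 1 else 0)
      = ∑ M ∈ Finset.univ.filter (fun M : Finset (Fin n) => S ⊆ M), PP n M := by
    rw [Finset.sum_filter]
    exact Finset.sum_congr rfl fun M _ => by split_ifs <;> simp
  rw [h1]
  have h2 : ∑ M ∈ Finset.univ.filter (fun M : Finset (Fin n) => S ⊆ M), PP n M
      = ∑ T ∈ (Sᶜ).powerset, (1 / (n:ℝ)) ^ S.card *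
        ((1 / (n:ℝ)) ^ T.card * (1 - 1 / (n:ℝ)) ^ ((Sᶜ).card - T.card)) := by
    refine Finset.sum_bij' (fun M _ => M \ S) (fun T _ => T ∪ S) ?_ ?_ ?_ ?_ ?_
    · intro M hM
      simp only [Finset.mem_powerset]
      intro i hi
      simp at hi ⊢
      exact hi.2
    · intro T hT
      simp
    · intro M hM
      simp at hM
      exact Finset.sdiff_union_of_subset hM
    · intro T hT
      simp only [Finset.mem_powerset] at hT
      rw [Finset.union_sdiff_right]
      apply Finset.sdiff_eq_self_of_disjoint
      exact Finset.disjoint_left.2 fun i hi hS => by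
        have := hT hi
        simp at this
        exact this hS
    · intro M hM
      simp at hM
      unfold PP
      have h3 : (M \ S).card = M.card - S.card := Finset.card_sdiff_of_subset hM
      have h4 := Finset.card_le_card hM
      have h5 : (Sᶜ).card = n - S.card := by simp [Finset.card_compl]
      rw [h3, h5, ← mul_assoc, ← pow_add]
      congr 2 <;> omega
  rw [h2, ← Finset.mul_sum, Finset.sum_pow_mul_eq_add_pow]
  simp

lemma PP_sum (n : ℕ) : ∑ M : Finset (Fin n), PP n M = 1 := by
  have := PP_subset n ∅
  simpa using this

lemma E_m {n : ℕ} (i : Fin n) : ∑ M, PP n M * mm M i = 1 / n := by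
  have := PP_subset n {i}
  simpa [mm] using this

lemma E_mm {n : ℕ} (i j : Fin n) (h : i ≠ j) : ∑ M, PP n M * (mm M i * mm M j) = 1 / (n:ℝ)^2 := by
  have := PP_subset n {i, j}
  rw [Finset.card_pair h, one_div_pow] at this
  rw [← this]
  refine Finset.sum_congr rfl fun M _ => ?_
  unfold mm
  by_cases h1 : i ∈ M <;> by_cases h2 : j ∈ M <;> simp [h1, h2, Finset.insert_subset_iff]

lemma E_mmm {n : ℕ} (i j k : Fin n) (h : i ≠ j) (h2 : i ≠ k) (h3 : j ≠ k) :
    ∑ M, PP n M * (mm M i * mm M j * mm M k) = 1 / (n:ℝ)^3 := by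
  have := PP_subset n {i, j, k}
  rw [Finset.card_eq_three.2 ⟨i, j, k, h, h2, h3, rfl⟩, one_div_pow] at this
  rw [← this]
  refine Finset.sum_congr rfl fun M _ => ?_
  unfold mm
  by_cases h1 : i ∈ M <;> by_cases h2 : j ∈ M <;> by_cases h3 : k ∈ M <;>
    simp [h1, h2, h3, Finset.insert_subset_iff]

lemma mm_sq {n : ℕ} (M : Finset (Fin n)) (i : Fin n) : mm M i * mm M i = mm M i := by
  rcases mm_cases M i with h | h <;> simp [h]

lemma sum_E_mmm {n : ℕ} (j k : Fin n) (h3 : j ≠ k) :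
    ∑ i ∈ Finset.univ.erase j, ∑ M, PP n M * (mm M i * mm M j * mm M k) ≤ 2 / (n:ℝ)^2 := by
  have hn : (0:ℝ) < n := by exact_mod_cast j.pos
  have hb : ∀ i ∈ Finset.univ.erase j, ∑ M, PP n M * (mm M i * mm M j * mm M k)
      ≤ 1 / (n:ℝ)^3 + if i = k then 1 / (n:ℝ)^2 else 0 := by
    intro i hi
    have hij : i ≠ j := Finset.ne_of_mem_erase hi
    by_cases hik : i = k
    · subst hik
      rw [if_pos rfl, ← E_mm i j hij]
      have : ∑ M, PP n M * (mm M i * mm M j * mm M i) = ∑ M, PP n M * (mm M i * mm M j) :=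
        Finset.sum_congr rfl fun M _ => by
          rw [mul_right_comm, mm_sq]
      rw [this]
      have : (0:ℝ) ≤ 1 / (n:ℝ)^3 := by positivity
      linarith
    · rw [if_neg hik, E_mmm i j k hij hik h3]; simp
  calc _ ≤ ∑ i ∈ Finset.univ.erase j, (1 / (n:ℝ)^3 + if i = k then 1 / (n:ℝ)^2 else 0) :=
        Finset.sum_le_sum hb
    _ ≤ ∑ i : Fin n, (1 / (n:ℝ)^3 + if i = k then 1 / (n:ℝ)^2 else 0) := by
        apply Finset.sum_le_sum_of_subset_of_nonneg (Finset.subset_univ _)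
        intro i _ _
        positivity
    _ = 2 / (n:ℝ)^2 := by
        rw [Finset.sum_add_distrib]
        simp
        field_simp
        norm_num

lemma PP_single {n : ℕ} (hn : 2 ≤ n) (i : Fin n) : 1 / (4 * (n:ℝ)) ≤ PP n {i} := by
  unfold PP
  obtain ⟨m, rfl⟩ : ∃ m, n = m + 1 := ⟨n - 1, by omega⟩
  have hm : (0:ℝ) < m := by
    have : 0 < m := by omega
    exact_mod_cast this
  have h1 : (1 + 1 / (m:ℝ)) ^ m ≤ 4 := by
    calc (1 + 1 / (m:ℝ)) ^ m ≤ (Real.exp (1 / m)) ^ m := by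
          apply pow_le_pow_left₀ (by positivity)
          linarith [Real.add_one_le_exp (1 / (m:ℝ))]
      _ = Real.exp 1 := by rw [← Real.exp_nat_mul]; congr 1; field_simp
      _ ≤ 4 := by linarith [Real.exp_one_lt_d9]
  have h2 : (1 - 1 / ((m+1 : ℕ):ℝ)) = (1 + 1 / (m:ℝ))⁻¹ := by
    push_cast
    field_simp
    ring
  simp only [Finset.card_singleton, pow_one, Nat.add_sub_cancel]
  rw [h2, inv_pow, one_div_mul_eq_div, div_le_div_iff₀ (by positivity) (by positivity), one_mul]
  have h3 : (0:ℝ) < (1 + 1 / (m:ℝ)) ^ m := by positivity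
  have h4 : (1/4:ℝ) ≤ ((1 + 1 / (m:ℝ)) ^ m)⁻¹ := by
    rw [one_div]; exact inv_anti₀ h3 h1
  nlinarith [(Nat.cast_nonneg (m+1) : (0:ℝ) ≤ ((m+1 : ℕ):ℝ))]

/-! ### the drift of the magnetization -/

def ac {n : ℕ} [NeZero n] (x : BitString n) (M : Finset (Fin n)) : ℝ :=
  if dd (flp x M) ≤ dd x then 1 else 0

def pr {n : ℕ} [NeZero n] (x : BitString n) (i : Fin n) : ℝ := ∑ M, PP n M * (mm M i * ac x M)

def SS {n : ℕ} [NeZero n] (x : BitString n) (i : Fin n) : ℝ := if qq x i = -1 then 1 else 0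
def ZZ {n : ℕ} [NeZero n] (x : BitString n) (i : Fin n) : ℝ := if qq x i = 0 then 1 else 0
def II {n : ℕ} [NeZero n] (x : BitString n) (i : Fin n) : ℝ := if qq x i = 1 then 1 else 0
def sn {n : ℕ} [NeZero n] (x : BitString n) : ℝ := ∑ i, SS x i

lemma ac_cases {n : ℕ} [NeZero n] (x : BitString n) (M : Finset (Fin n)) : ac x M = 0 ∨ ac x M = 1 := by
  unfold ac; split_ifs <;> simp

lemma SS_nonneg {n : ℕ} [NeZero n] (x : BitString n) (i : Fin n) : 0 ≤ SS x i := by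
  unfold SS; split_ifs <;> simp
lemma ZZ_nonneg {n : ℕ} [NeZero n] (x : BitString n) (i : Fin n) : 0 ≤ ZZ x i := by
  unfold ZZ; split_ifs <;> simp
lemma II_nonneg {n : ℕ} [NeZero n] (x : BitString n) (i : Fin n) : 0 ≤ II x i := by
  unfold II; split_ifs <;> simp

lemma sum_one_sub_qq {n : ℕ} [NeZero n] (x : BitString n) (f : Fin n → ℝ) :
    ∑ i, f i * (1 - qq x i) = ∑ i, Dd x i * (f i + f (i+1)) := by
  have h := sum_shift (fun i => Dd x (i-1) * f i)
  simp only [add_sub_cancel_right] at h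
  have h1 : ∑ i, Dd x i * (f i + f (i+1)) = ∑ i, Dd x i * f i + ∑ i, Dd x i * f (i+1) := by
    rw [← Finset.sum_add_distrib]; exact Finset.sum_congr rfl fun i _ => by ring
  rw [h1, h, ← Finset.sum_add_distrib]
  exact Finset.sum_congr rfl fun i _ => by unfold qq; ring

lemma sum_one_sub_qq' {n : ℕ} [NeZero n] (x : BitString n) :
    ∑ i, (1 - qq x i) = 2 * dd x := by
  have := sum_one_sub_qq x (fun _ => 1)
  simp only [one_mul] at this
  rw [this, dd, Finset.mul_sum]
  exact Finset.sum_congr rfl fun i _ => by ring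

lemma sum_ZZ {n : ℕ} [NeZero n] (x : BitString n) : ∑ i, ZZ x i ≤ 2 * dd x := by
  rw [← sum_one_sub_qq']
  refine Finset.sum_le_sum fun i _ => ?_
  unfold ZZ
  rcases qq_cases x i with h | h | h <;> rw [h] <;> norm_num

lemma sum_ZS {n : ℕ} [NeZero n] (x : BitString n) : ∑ i, (ZZ x i + SS x i) ≤ 2 * dd x := by
  rw [← sum_one_sub_qq']
  refine Finset.sum_le_sum fun i _ => ?_
  unfold ZZ SS
  rcases qq_cases x i with h | h | h <;> rw [h] <;> norm_num

lemma sum_ZS' {n : ℕ} [NeZero n] (x : BitString n) : dd x ≤ ∑ i, (ZZ x i + SS x i) := by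
  have : 2 * dd x ≤ 2 * ∑ i, (ZZ x i + SS x i) := by
    rw [← sum_one_sub_qq', Finset.mul_sum]
    refine Finset.sum_le_sum fun i _ => ?_
    unfold ZZ SS
    rcases qq_cases x i with h | h | h <;> rw [h] <;> norm_num
  linarith

lemma pr_nonneg {n : ℕ} [NeZero n] (x : BitString n) (i : Fin n) : 0 ≤ pr x i :=
  Finset.sum_nonneg fun M _ => mul_nonneg (PP_nonneg n M) (mul_nonneg (mm_nonneg M i)
    (by rcases ac_cases x M with h | h <;> simp [h]))

lemma pr_le {n : ℕ} [NeZero n] (x : BitString n) (i : Fin n) : pr x i ≤ 1 / n := by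
  rw [← E_m i]
  refine Finset.sum_le_sum fun M _ => mul_le_mul_of_nonneg_left ?_ (PP_nonneg n M)
  rcases ac_cases x M with h | h <;> simp [h, mm_nonneg]

lemma succ_ne {n : ℕ} [NeZero n] (hn : 2 ≤ n) (j : Fin n) : j ≠ j + 1 := by
  have h3 : n ≠ 1 := by omega
  simp [h3]

lemma pred_ne {n : ℕ} [NeZero n] (hn : 2 ≤ n) (j : Fin n) : j ≠ j - 1 := by
  have := succ_ne hn (j - 1)
  simp only [sub_add_cancel] at this
  exact this.symm

lemma interior_pointwise {n : ℕ} [NeZero n] (x : BitString n) (hx : ¬ isOpt x)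
    (M : Finset (Fin n)) (i : Fin n) :
    II x i * (mm M i * ac x M) ≤ ∑ j, (SS x j * (II x i * (mm M i * mm M j)) +
      ZZ x j * (II x i * (mm M i * mm M j * mm M (j+1)) + II x i * (mm M i * mm M j * mm M (j-1)))) := by
  have hnn : ∀ j, 0 ≤ SS x j * (II x i * (mm M i * mm M j)) +
      ZZ x j * (II x i * (mm M i * mm M j * mm M (j+1)) + II x i * (mm M i * mm M j * mm M (j-1))) := by
    intro j
    have := SS_nonneg x j
    have := ZZ_nonneg x j
    have := II_nonneg x i
    have := mm_nonneg M i
    have := mm_nonneg M j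
    have := mm_nonneg M (j+1)
    have := mm_nonneg M (j-1)
    positivity
  have hS : 0 ≤ ∑ j, (SS x j * (II x i * (mm M i * mm M j)) +
      ZZ x j * (II x i * (mm M i * mm M j * mm M (j+1)) + II x i * (mm M i * mm M j * mm M (j-1)))) :=
    Finset.sum_nonneg fun j _ => hnn j
  by_cases hq : qq x i = 1
  swap
  · have : II x i = 0 := by simp [II, hq]
    rw [this, zero_mul]; rw [this] at hS; exact hS
  by_cases hi : i ∈ M
  swap
  · rw [mm_zero.2 hi] at hS ⊢; simp only [zero_mul, mul_zero] at hS ⊢; simp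
  by_cases ha : dd (flp x M) ≤ dd x
  swap
  · have : ac x M = 0 := by simp [ac, ha]
    rw [this, mul_zero, mul_zero]; exact hS
  obtain ⟨j, hj, h⟩ := acc_interior x M hx ha i hi hq
  refine le_trans ?_ (Finset.single_le_sum (fun j _ => hnn j) (Finset.mem_univ j))
  have e1 : II x i = 1 := by simp [II, hq]
  have e2 : ac x M = 1 := by simp [ac, ha]
  rw [e1, e2, mm_one.2 hi, mm_one.2 hj]
  have := mm_nonneg M (j+1)
  have := mm_nonneg M (j-1)
  rcases h with h | ⟨h, h' | h'⟩
  · have : SS x j = 1 := by simp [SS, h]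
    have : ZZ x j = 0 := by simp [ZZ, h]
    simp_all
  · have : SS x j = 0 := by simp [SS, h]
    have : ZZ x j = 1 := by simp [ZZ, h]
    have := mm_one.2 h'
    simp_all
  · have : SS x j = 0 := by simp [SS, h]
    have : ZZ x j = 1 := by simp [ZZ, h]
    have := mm_one.2 h'
    simp_all

lemma sum_II_mm {n : ℕ} [NeZero n] (x : BitString n) (j : Fin n) :
    SS x j * ∑ i, ∑ M, PP n M * (II x i * (mm M i * mm M j)) ≤ SS x j * (1 / (n:ℝ)) := by
  have hn : (0:ℝ) < n := by exact_mod_cast j.pos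
  unfold SS
  split_ifs with h
  swap
  · simp
  rw [one_mul, one_mul]
  calc _ ≤ ∑ i : Fin n, 1 / (n:ℝ)^2 := by
        refine Finset.sum_le_sum fun i _ => ?_
        by_cases hij : i = j
        · have : II x i = 0 := by rw [hij]; simp [II, h]; norm_num
          simp [this]
        · rw [← E_mm i j hij]
          refine Finset.sum_le_sum fun M _ => mul_le_mul_of_nonneg_left ?_ (PP_nonneg n M)
          have := mul_nonneg (mm_nonneg M i) (mm_nonneg M j)
          unfold II; split_ifs <;> simp [this]
    _ = 1 / (n:ℝ) := by simp; field_simp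

lemma sum_II_mmm {n : ℕ} [NeZero n] (x : BitString n) (j k : Fin n) (hjk : j ≠ k) :
    ZZ x j * ∑ i, ∑ M, PP n M * (II x i * (mm M i * mm M j * mm M k)) ≤ ZZ x j * (2 / (n:ℝ)^2) := by
  unfold ZZ
  split_ifs with h
  swap
  · simp
  rw [one_mul, one_mul]
  refine le_trans ?_ (sum_E_mmm j k hjk)
  have hj : ∑ M, PP n M * (II x j * (mm M j * mm M j * mm M k)) = 0 := by
    have : II x j = 0 := by simp [II, h]
    simp [this]
  rw [← Finset.add_sum_erase _ _ (Finset.mem_univ j), hj, zero_add]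
  refine Finset.sum_le_sum fun i _ => Finset.sum_le_sum fun M _ => mul_le_mul_of_nonneg_left ?_ (PP_nonneg n M)
  have := mul_nonneg (mul_nonneg (mm_nonneg M i) (mm_nonneg M j)) (mm_nonneg M k)
  unfold II; split_ifs <;> simp [this]

lemma interior_bound {n : ℕ} [NeZero n] (hn : 2 ≤ n) (x : BitString n) (hx : ¬ isOpt x) :
    ∑ i, II x i * pr x i ≤ sn x / n + 8 * dd x / (n:ℝ)^2 := by
  calc ∑ i, II x i * pr x i = ∑ i, ∑ M, PP n M * (II x i * (mm M i * ac x M)) := by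
        refine Finset.sum_congr rfl fun i _ => ?_
        rw [pr, Finset.mul_sum]
        exact Finset.sum_congr rfl fun M _ => by ring
    _ ≤ ∑ i, ∑ M, PP n M * ∑ j, (SS x j * (II x i * (mm M i * mm M j)) +
      ZZ x j * (II x i * (mm M i * mm M j * mm M (j+1)) + II x i * (mm M i * mm M j * mm M (j-1)))) :=
        Finset.sum_le_sum fun i _ => Finset.sum_le_sum fun M _ =>
          mul_le_mul_of_nonneg_left (interior_pointwise x hx M i) (PP_nonneg n M)
    _ = ∑ j, (SS x j * ∑ i, ∑ M, PP n M * (II x i * (mm M i * mm M j))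
          + ZZ x j * ∑ i, ∑ M, PP n M * (II x i * (mm M i * mm M j * mm M (j+1)))
          + ZZ x j * ∑ i, ∑ M, PP n M * (II x i * (mm M i * mm M j * mm M (j-1)))) := by
        simp only [Finset.mul_sum, ← Finset.sum_add_distrib]
        rw [Finset.sum_congr rfl fun i _ => Finset.sum_comm, Finset.sum_comm]
        exact Finset.sum_congr rfl fun j _ => Finset.sum_congr rfl fun i _ =>
          Finset.sum_congr rfl fun M _ => by ring
    _ ≤ ∑ j, (SS x j * (1 / n) + ZZ x j * (2 / (n:ℝ)^2) + ZZ x j * (2 / (n:ℝ)^2)) :=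
        Finset.sum_le_sum fun j _ => add_le_add (add_le_add (sum_II_mm x j)
          (sum_II_mmm x j _ (succ_ne hn j))) (sum_II_mmm x j _ (pred_ne hn j))
    _ = sn x / n + (∑ j, ZZ x j) * (4 / (n:ℝ)^2) := by
        rw [sn, Finset.sum_div, Finset.sum_mul, ← Finset.sum_add_distrib]
        exact Finset.sum_congr rfl fun j _ => by ring
    _ ≤ sn x / n + (2 * dd x) * (4 / (n:ℝ)^2) := by
        have := mul_le_mul_of_nonneg_right (sum_ZZ x) (by positivity : (0:ℝ) ≤ 4 / (n:ℝ)^2)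
        linarith
    _ = _ := by ring

lemma PP_map {n : ℕ} (M : Finset (Fin n)) (e : Equiv.Perm (Fin n)) :
    PP n (M.map e.toEmbedding) = PP n M := by
  unfold PP; rw [Finset.card_map]

lemma sum_map {n : ℕ} (e : Equiv.Perm (Fin n)) (f : Finset (Fin n) → ℝ) :
    ∑ M : Finset (Fin n), f (M.map e.toEmbedding) = ∑ M, f M :=
  Equiv.sum_comp (Equiv.finsetCongr e) f

lemma pair_pointwise {n : ℕ} [NeZero n] (hn : 4 ≤ n) (x : BitString n) (i : Fin n)
    (h1 : qq x i = 0) (h2 : qq x (i+1) = 0) (M : Finset (Fin n)) :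
    |mm M i * ac x M - mm (M.map (Equiv.swap i (i+1)).toEmbedding) (i+1) *
      ac x (M.map (Equiv.swap i (i+1)).toEmbedding)| ≤
      mm M i * mm M (i-1) + mm M i * mm M (i+1+1) := by
  have hmem : ∀ k, k ∈ M.map (Equiv.swap i (i+1)).toEmbedding ↔ Equiv.swap i (i+1) k ∈ M := by
    intro k
    rw [Finset.mem_map_equiv, Equiv.symm_swap]
  have e1 : mm (M.map (Equiv.swap i (i+1)).toEmbedding) (i+1) = mm M i := by
    unfold mm
    simp only [hmem, Equiv.swap_apply_right]
  rw [e1, ← mul_sub]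
  by_cases hi : i ∈ M
  swap
  · simp [mm_zero.2 hi]
  rw [mm_one.2 hi, one_mul, one_mul, one_mul]
  have hnn1 := mm_nonneg M (i-1)
  have hnn2 := mm_nonneg M (i+1+1)
  have habs : |ac x M - ac x (M.map (Equiv.swap i (i+1)).toEmbedding)| ≤ 1 := by
    rcases ac_cases x M with h | h <;>
    rcases ac_cases x (M.map (Equiv.swap i (i+1)).toEmbedding) with h' | h' <;> rw [h, h'] <;> norm_num
  by_cases hm : i - 1 ∈ M
  · rw [mm_one.2 hm]; linarith
  by_cases hp : i + 1 + 1 ∈ M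
  · rw [mm_one.2 hp]; linarith
  have hz : ac x M = ac x (M.map (Equiv.swap i (i+1)).toEmbedding) := by
    by_cases hj : i + 1 ∈ M
    · congr 1
      ext k
      rw [hmem]
      by_cases k1 : k = i
      · subst k1; simp [hi, hj]
      · by_cases k2 : k = i + 1
        · subst k2; simp [hi, hj]
        · rw [Equiv.swap_apply_of_ne_of_ne k1 k2]
    · have n1 := succ_ne (by omega) i
      have n2 := succ_ne (by omega) (i+1)
      have n3 : i + 1 + 1 ≠ i := by
        intro h
        have := congrArg Fin.val (add_eq_left.1 ((add_assoc i 1 1).symm.trans h))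
        rw [Fin.val_add, Fin.val_one', Fin.val_zero] at this
        rw [Nat.mod_eq_of_lt (a := 1) (by omega), Nat.mod_eq_of_lt (by omega)] at this
        omega
      have n4 := pred_ne (by omega) i
      have A : M = insert i (M.erase i) := (Finset.insert_erase hi).symm
      have B : M.map (Equiv.swap i (i+1)).toEmbedding = insert (i+1) (M.erase i) := by
        ext k
        rw [hmem, Finset.mem_insert, Finset.mem_erase]
        by_cases k1 : k = i
        · subst k1; simp [hj]; omega
        · by_cases k2 : k = i + 1
          · subst k2; simp [hi]
          · rw [Equiv.swap_apply_of_ne_of_ne k1 k2]; simp [k1, k2]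
      have C1 : dd (flp x M) = dd (flp x (M.erase i)) := by
        conv_lhs => rw [A]
        exact dd_insert (by omega) x _ i (by simp) (by simp [hj]) (by simp [hm]) h1
      have C2 : dd (flp x (M.map (Equiv.swap i (i+1)).toEmbedding)) = dd (flp x (M.erase i)) := by
        rw [B]
        exact dd_insert (by omega) x _ (i+1) (by simp [hj]) (by simp [hp]) (by simp) h2
      unfold ac
      rw [C1, C2]
  rw [hz, sub_self, abs_zero]; linarith

lemma pair_bound {n : ℕ} [NeZero n] (hn : 4 ≤ n) (x : BitString n) (i : Fin n)
    (h1 : qq x i = 0) (h2 : qq x (i+1) = 0) : |pr x i - pr x (i+1)| ≤ 2 / (n:ℝ)^2 := by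
  have n4 := pred_ne (by omega) i
  have n3 : i ≠ i + 1 + 1 := by
    intro h
    have := congrArg Fin.val (add_eq_left.1 ((add_assoc i 1 1).symm.trans h.symm))
    rw [Fin.val_add, Fin.val_one', Fin.val_zero] at this
    rw [Nat.mod_eq_of_lt (a := 1) (by omega), Nat.mod_eq_of_lt (by omega)] at this
    omega
  have e : pr x (i+1) = ∑ M, PP n M * (mm (M.map (Equiv.swap i (i+1)).toEmbedding) (i+1) *
      ac x (M.map (Equiv.swap i (i+1)).toEmbedding)) := by
    unfold pr
    rw [← sum_map (Equiv.swap i (i+1))]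
    exact Finset.sum_congr rfl fun M _ => by rw [PP_map]
  rw [e, pr, ← Finset.sum_sub_distrib]
  calc _ ≤ ∑ M, PP n M * (mm M i * mm M (i-1) + mm M i * mm M (i+1+1)) := by
        refine (Finset.abs_sum_le_sum_abs _ _).trans (Finset.sum_le_sum fun M _ => ?_)
        rw [← mul_sub, abs_mul, abs_of_nonneg (PP_nonneg n M)]
        exact mul_le_mul_of_nonneg_left (pair_pointwise hn x i h1 h2 M) (PP_nonneg n M)
    _ = 2 / (n:ℝ)^2 := by
        simp only [mul_add, Finset.sum_add_distrib]
        rw [E_mm _ _ n4, E_mm _ _ n3]; ring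

lemma edge_bound {n : ℕ} [NeZero n] (hn : 4 ≤ n) (x : BitString n) (i : Fin n) :
    |Dd x i * (sg x i * pr x i + sg x (i+1) * pr x (i+1))| ≤
      Dd x i * (2 / (n:ℝ)^2) + (2 / n) * (SS x i + SS x (i+1)) := by
  have hS1 := SS_nonneg x i
  have hS2 := SS_nonneg x (i+1)
  have hn0 : (0:ℝ) < n := by exact_mod_cast i.pos
  have hi : (0:ℝ) ≤ 2 / n := by positivity
  rcases Dd_cases x i with h | h
  · rw [h]; simp; positivity
  have hs : sg x (i+1) = - sg x i := by
    unfold Dd at h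
    unfold sg
    rcases h1 : x i <;> rcases h2 : x (i+1) <;> simp_all
  have e : Dd x i * (sg x i * pr x i + sg x (i+1) * pr x (i+1)) = sg x i * (pr x i - pr x (i+1)) := by
    rw [h, hs]; ring
  rw [e, abs_mul, abs_sg, one_mul, h, one_mul]
  have hcr : |pr x i - pr x (i+1)| ≤ 2 / n := by
    have := pr_le x i
    have := pr_le x (i+1)
    have := pr_nonneg x i
    have := pr_nonneg x (i+1)
    have h3 : (2:ℝ) / n = 1 / n + 1 / n := by ring
    rw [abs_le]; constructor <;> linarith
  have hp : (0:ℝ) ≤ 2 / (n:ℝ)^2 := by positivity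
  rcases qq_cases x i with h1 | h1 | h1
  · exfalso
    unfold qq at h1
    rcases Dd_cases x (i-1) with h' | h' <;> linarith
  · rcases qq_cases x (i+1) with h2 | h2 | h2
    · exfalso
      unfold qq at h2
      rw [add_sub_cancel_right] at h2
      rcases Dd_cases x (i+1) with h' | h' <;> linarith
    · have := pair_bound hn x i h1 h2
      have := mul_nonneg hi (add_nonneg hS1 hS2)
      linarith
    · have : SS x (i+1) = 1 := by simp [SS, h2]
      rw [this]
      nlinarith
  · have : SS x i = 1 := by simp [SS, h1]
    rw [this]
    nlinarith

lemma key_bound {n : ℕ} [NeZero n] (hn : 4 ≤ n) (x : BitString n) (hx : ¬ isOpt x) :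
    |∑ i, sg x i * pr x i| ≤ 6 * sn x / n + 10 * dd x / (n:ℝ)^2 := by
  have hdec : ∑ i, sg x i * pr x i = ∑ i, Dd x i * (sg x i * pr x i + sg x (i+1) * pr x (i+1))
      + ∑ i, II x i * (sg x i * pr x i) - ∑ i, SS x i * (sg x i * pr x i) := by
    rw [← sum_one_sub_qq x (fun i => sg x i * pr x i), ← Finset.sum_add_distrib, ← Finset.sum_sub_distrib]
    refine Finset.sum_congr rfl fun i _ => ?_
    unfold II SS
    rcases qq_cases x i with h | h | h <;> rw [h] <;> norm_num
    ring
  have b1 : |∑ i, Dd x i * (sg x i * pr x i + sg x (i+1) * pr x (i+1))| ≤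
      2 * dd x / (n:ℝ)^2 + 4 * sn x / n := by
    refine (Finset.abs_sum_le_sum_abs _ _).trans ((Finset.sum_le_sum fun i _ => edge_bound hn x i).trans ?_)
    rw [Finset.sum_add_distrib, ← Finset.sum_mul, ← Finset.mul_sum, Finset.sum_add_distrib, sum_shift (SS x)]
    apply le_of_eq
    unfold dd sn; ring
  have b2 : |∑ i, II x i * (sg x i * pr x i)| ≤ sn x / n + 8 * dd x / (n:ℝ)^2 := by
    refine (Finset.abs_sum_le_sum_abs _ _).trans (le_trans (le_of_eq ?_) (interior_bound (by omega) x hx))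
    refine Finset.sum_congr rfl fun i _ => ?_
    rw [abs_mul, abs_mul, abs_sg, one_mul, abs_of_nonneg (II_nonneg x i), abs_of_nonneg (pr_nonneg x i)]
  have b3 : |∑ i, SS x i * (sg x i * pr x i)| ≤ sn x / n := by
    refine (Finset.abs_sum_le_sum_abs _ _).trans ?_
    rw [sn, Finset.sum_div]
    refine Finset.sum_le_sum fun i _ => ?_
    rw [abs_mul, abs_mul, abs_sg, one_mul, abs_of_nonneg (SS_nonneg x i), abs_of_nonneg (pr_nonneg x i), div_eq_mul_one_div]
    exact mul_le_mul_of_nonneg_left (pr_le x i) (SS_nonneg x i)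
  rw [hdec]
  have e : 6 * sn x / n + 10 * dd x / (n:ℝ)^2 = (2 * dd x / (n:ℝ)^2 + 4 * sn x / n) + (sn x / n + 8 * dd x / (n:ℝ)^2) + sn x / n := by ring
  rw [e]
  exact (abs_sub _ _).trans (add_le_add ((abs_add_le _ _).trans (add_le_add b1 b2)) b3)

/-! ### Markov chain lemmas -/

lemma probOf_eq {S : Type*} [Fintype S] (d : S → ℝ≥0∞) (A : S → Prop) :
    probOf d A = ∑ s, d s * (if A s then 1 else 0) := by
  unfold probOf
  exact Finset.sum_congr rfl fun s _ => by split_ifs <;> simp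

lemma evolve_swap {S : Type*} [Fintype S] (init : S → ℝ≥0∞) (tr : S → S → ℝ≥0∞) (V : S → ℝ≥0∞) (T : ℕ) :
    ∑ s', evolve init tr (T+1) s' * V s' = ∑ s, evolve init tr T s * ∑ s', tr s s' * V s' := by
  simp only [evolve, Finset.sum_mul, Finset.mul_sum]
  rw [Finset.sum_comm]
  exact Finset.sum_congr rfl fun s _ => Finset.sum_congr rfl fun s' _ => by rw [mul_assoc]

lemma upper_chain {S : Type*} [Fintype S] (init : S → ℝ≥0∞) (tr : S → S → ℝ≥0∞) (V : S → ℝ≥0∞)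
    (A : S → Prop) (h : ∀ s, (if A s then 1 else 0) + ∑ s', tr s s' * V s' ≤ V s) :
    ∑' T, probOf (evolve init tr T) A ≤ ∑ s, init s * V s := by
  apply ENNReal.tsum_le_of_sum_range_le
  intro N
  have : ∑ T ∈ Finset.range N, probOf (evolve init tr T) A + ∑ s, evolve init tr N s * V s
      ≤ ∑ s, init s * V s := by
    induction N with
    | zero => simp [evolve]
    | succ N ih =>
      refine le_trans ?_ ih
      rw [Finset.sum_range_succ, add_assoc]
      gcongr
      rw [evolve_swap, probOf_eq, ← Finset.sum_add_distrib]
      refine Finset.sum_le_sum fun s _ => ?_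
      rw [← mul_add]
      gcongr
      exact h s
  exact le_trans le_self_add this

lemma lower_chain {S : Type*} [Fintype S] (init : S → ℝ≥0∞) (tr : S → S → ℝ≥0∞) (V : S → ℝ≥0∞)
    (A : S → Prop) (B : ℝ≥0∞) (hB : B ≠ ∞) (hV : ∀ s, V s ≤ B * (if A s then 1 else 0))
    (h : ∀ s, V s ≤ (if A s then 1 else 0) + ∑ s', tr s s' * V s') :
    ∑ s, init s * V s ≤ ∑' T, probOf (evolve init tr T) A := by
  by_cases hT : ∑' T, probOf (evolve init tr T) A = ∞
  · rw [hT]; exact le_top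
  have h1 : ∀ N, ∑ s, init s * V s ≤
      ∑ T ∈ Finset.range N, probOf (evolve init tr T) A + ∑ s, evolve init tr N s * V s := by
    intro N
    induction N with
    | zero => simp [evolve]
    | succ N ih =>
      refine le_trans ih ?_
      rw [Finset.sum_range_succ, add_assoc]
      gcongr
      rw [evolve_swap, probOf_eq, ← Finset.sum_add_distrib]
      refine Finset.sum_le_sum fun s _ => ?_
      rw [← mul_add]
      gcongr
      exact h s
  have h2 : ∀ N, ∑ s, init s * V s ≤
      ∑' T, probOf (evolve init tr T) A + B * probOf (evolve init tr N) A := by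
    intro N
    refine (h1 N).trans (add_le_add (ENNReal.sum_le_tsum _) ?_)
    rw [probOf_eq, Finset.mul_sum]
    refine Finset.sum_le_sum fun s _ => ?_
    calc _ ≤ evolve init tr N s * (B * (if A s then 1 else 0)) := by gcongr; exact hV s
      _ = _ := by rw [mul_left_comm]
  have h3 : Tendsto (fun N => probOf (evolve init tr N) A) atTop (nhds 0) :=
    ENNReal.tendsto_atTop_zero_of_tsum_ne_top hT
  have h4 : Tendsto (fun N => ∑' T, probOf (evolve init tr T) A + B * probOf (evolve init tr N) A) atTop
      (nhds (∑' T, probOf (evolve init tr T) A + B * 0)) :=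
    tendsto_const_nhds.add (ENNReal.Tendsto.const_mul h3 (Or.inr hB))
  rw [mul_zero, add_zero] at h4
  exact ge_of_tendsto' h4 h2

lemma trans_sum {n : ℕ} (s : State n) (V : State n → ℝ≥0∞) :
    ∑ s', trans n s s' * V s' = ∑ y, mutProb n s.1 y *
      V (if isingFit s.1 ≤ isingFit y then y else s.1, s.2 || decide (isOpt y)) := by
  unfold trans
  simp only [Finset.sum_mul]
  rw [Finset.sum_comm]
  refine Finset.sum_congr rfl fun y _ => ?_
  rw [Finset.sum_eq_single (if isingFit s.1 ≤ isingFit y then y else s.1, s.2 || decide (isOpt y))]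
  · simp
  · intro b _ hb
    rw [if_neg, mul_zero, zero_mul]
    rintro ⟨h1, h2⟩
    exact hb (Prod.ext h1 h2)
  · simp

def flpEquiv {n : ℕ} (x : BitString n) : Finset (Fin n) ≃ BitString n where
  toFun M := flp x M
  invFun y := Finset.univ.filter fun i => x i ≠ y i
  left_inv M := by
    ext i
    by_cases h : i ∈ M <;> simp [flp, h]
  right_inv y := by
    funext i
    unfold flp
    rcases h1 : x i <;> rcases h2 : y i <;> simp [h1, h2]

lemma mutProb_flp {n : ℕ} [NeZero n] (x : BitString n) (M : Finset (Fin n)) :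
    mutProb n x (flp x M) = ENNReal.ofReal (PP n M) := by
  have hd : hammingDist x (flp x M) = M.card := by
    unfold hammingDist
    congr 1
    ext i
    by_cases h : i ∈ M <;> simp [flp, h]
  have hn : (0:ℝ) < n := by exact_mod_cast NeZero.pos n
  have e : (n : ℝ≥0∞)⁻¹ = ENNReal.ofReal (1 / n) := by
    rw [one_div, ENNReal.ofReal_inv_of_pos hn, ENNReal.ofReal_natCast]
  have h1 := inv_n_nonneg n
  unfold mutProb PP
  rw [hd, e, ENNReal.ofReal_mul (by positivity), ENNReal.ofReal_pow (by positivity), ENNReal.ofReal_pow h1,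
    ENNReal.ofReal_sub _ (by positivity), ENNReal.ofReal_one]

def nxt {n : ℕ} [NeZero n] (x : BitString n) (M : Finset (Fin n)) : BitString n :=
  if dd (flp x M) ≤ dd x then flp x M else x

lemma step_sum {n : ℕ} [NeZero n] (x : BitString n) (hx : ¬ isOpt x) (v : BitString n → ℝ)
    (hv : ∀ y, 0 ≤ v y) (hv0 : ∀ y, isOpt y → v y = 0) (V : State n → ℝ≥0∞)
    (hV1 : ∀ y, V (y, true) = 0) (hV2 : ∀ y, ¬ isOpt y → V (y, false) = ENNReal.ofReal (v y)) :
    ∑ s', trans n (x, false) s' * V s' = ENNReal.ofReal (∑ M, PP n M * v (nxt x M)) := by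
  rw [trans_sum, ← Equiv.sum_comp (flpEquiv x), ENNReal.ofReal_sum_of_nonneg
    (fun M _ => mul_nonneg (PP_nonneg n M) (hv _))]
  refine Finset.sum_congr rfl fun M _ => ?_
  rw [ENNReal.ofReal_mul (PP_nonneg n M)]
  change mutProb n x (flp x M) * V (if isingFit x ≤ isingFit (flp x M) then flp x M else x,
    false || decide (isOpt (flp x M))) = _
  rw [mutProb_flp]
  congr 1
  unfold nxt
  simp only [fit_le_iff, Bool.false_or]
  by_cases ho : isOpt (flp x M)
  · have h0 : dd (flp x M) = 0 := (isOpt_iff _).1 ho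
    have : dd (flp x M) ≤ dd x := by rw [h0]; exact dd_nonneg x
    simp only [this, if_true, ho, decide_true, hV1, hv0 _ ho, ENNReal.ofReal_zero]
  · simp only [ho, decide_false]
    apply hV2
    split_ifs <;> assumption

lemma flagged_sum {n : ℕ} (x : BitString n) (V : State n → ℝ≥0∞) (hV1 : ∀ y, V (y, true) = 0) :
    ∑ s', trans n (x, true) s' * V s' = 0 := by
  rw [trans_sum]
  exact Finset.sum_eq_zero fun y _ => by simp [hV1]

lemma expOpt_upper {n : ℕ} [NeZero n] (v : BitString n → ℝ)
    (hv : ∀ y, 0 ≤ v y) (hv0 : ∀ y, isOpt y → v y = 0)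
    (hstep : ∀ x, ¬ isOpt x → 1 + ∑ M, PP n M * v (nxt x M) ≤ v x) (init : State n → ℝ≥0∞) (B : ℝ)
    (hB : ∀ y, v y ≤ B)
    (hi : ∀ s, isOpt s.1 → s.2 = false → init s = 0) (hi1 : ∑ s, init s ≤ 1) :
    expOpt init ≤ ENNReal.ofReal B := by
  let V : State n → ℝ≥0∞ := fun s => if s.2 = true then 0 else if isOpt s.1 then ∞ else ENNReal.ofReal (v s.1)
  have hV1 : ∀ y, V (y, true) = 0 := fun y => by simp [V]
  have hV2 : ∀ y, ¬ isOpt y → V (y, false) = ENNReal.ofReal (v y) := fun y hy => by simp [V, hy]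
  have h := upper_chain init (trans n) V (fun s => ¬ s.2 = true) (by
    rintro ⟨x, b⟩
    rcases b with _ | _
    · by_cases hx : isOpt x
      · have : V (x, false) = ∞ := by simp [V, hx]
        rw [this]; exact le_top
      · rw [step_sum x hx v hv hv0 V hV1 hV2, hV2 x hx]
        have h1 : (1 : ℝ≥0∞) = ENNReal.ofReal 1 := by simp
        rw [if_pos (by simp), h1, ← ENNReal.ofReal_add zero_le_one (Finset.sum_nonneg fun M _ => mul_nonneg (PP_nonneg n M) (hv _))]
        exact ENNReal.ofReal_le_ofReal (hstep x hx)
    · rw [flagged_sum x V hV1]; simp)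
  refine le_trans h ?_
  calc ∑ s, init s * V s ≤ ∑ s, init s * ENNReal.ofReal B := by
        refine Finset.sum_le_sum fun s _ => ?_
        obtain ⟨x, b⟩ := s
        rcases b with _ | _
        · by_cases hx : isOpt x
          · rw [hi _ hx rfl]; simp
          · rw [hV2 x hx]; gcongr; exact hB x
        · rw [hV1]; simp
    _ = (∑ s, init s) * ENNReal.ofReal B := by rw [Finset.sum_mul]
    _ ≤ 1 * ENNReal.ofReal B := by gcongr
    _ = _ := one_mul _

lemma expOpt_lower {n : ℕ} [NeZero n] (v : BitString n → ℝ)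
    (hv : ∀ y, 0 ≤ v y) (hv0 : ∀ y, isOpt y → v y = 0)
    (hstep : ∀ x, ¬ isOpt x → v x ≤ 1 + ∑ M, PP n M * v (nxt x M)) (B : ℝ)
    (hB : ∀ y, v y ≤ B) (x0 : BitString n) (hx0 : ¬ isOpt x0) :
    ENNReal.ofReal (v x0) ≤ expOpt (initAt x0) := by
  let V : State n → ℝ≥0∞ := fun s => if s.2 = true then 0 else ENNReal.ofReal (v s.1)
  have hV1 : ∀ y, V (y, true) = 0 := fun y => by simp [V]
  have hV2 : ∀ y, V (y, false) = ENNReal.ofReal (v y) := fun y => by simp [V]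
  have h := lower_chain (initAt x0) (trans n) V (fun s => ¬ s.2 = true) (ENNReal.ofReal B)
    ENNReal.ofReal_ne_top (by
      rintro ⟨x, b⟩
      rcases b with _ | _
      · rw [hV2]; simp; exact ENNReal.ofReal_le_ofReal (hB x)
      · rw [hV1]; exact zero_le) (by
    rintro ⟨x, b⟩
    rcases b with _ | _
    · by_cases hx : isOpt x
      · rw [hV2, hv0 x hx]; simp
      · rw [step_sum x hx v hv hv0 V hV1 (fun y _ => hV2 y), hV2 x]
        have h1 : (1 : ℝ≥0∞) = ENNReal.ofReal 1 := by simp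
        rw [if_pos (by simp), h1, ← ENNReal.ofReal_add zero_le_one (Finset.sum_nonneg fun M _ => mul_nonneg (PP_nonneg n M) (hv _))]
        exact ENNReal.ofReal_le_ofReal (hstep x hx)
    · rw [hV1]; exact zero_le)
  refine le_trans ?_ h
  refine le_trans ?_ (Finset.single_le_sum (f := fun s => initAt x0 s * V s) (fun _ _ => zero_le)
    (Finset.mem_univ ((x0, false) : State n)))
  simp [initAt, hx0, V]

lemma initU_sum (n : ℕ) : ∑ s, initU n s ≤ 1 := by
  rw [Fintype.sum_prod_type]
  have : ∀ x : BitString n, ∑ b, initU n (x, b) = ((2 : ℝ≥0∞) ^ n)⁻¹ := by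
    intro x
    unfold initU
    by_cases h : isOpt x <;> simp [h]
  simp only [this, Finset.sum_const, Finset.card_univ]
  simp

lemma initU_opt (n : ℕ) (s : State n) (h : isOpt s.1) (h2 : s.2 = false) : initU n s = 0 := by
  simp [initU, h, h2]

lemma initAt_sum {n : ℕ} (x : BitString n) : ∑ s, initAt x s ≤ 1 := by
  simp [initAt]

lemma initAt_opt {n : ℕ} (x : BitString n) (s : State n) (h : isOpt s.1) (h2 : s.2 = false) :
    initAt x s = 0 := by
  unfold initAt
  rw [if_neg]
  rintro rfl
  simp at h2
  exact h2 h

/-! ### upper bound -/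

lemma nxt_sum {n : ℕ} [NeZero n] (x : BitString n) (v : BitString n → ℝ) :
    ∑ M, PP n M * v (nxt x M) = v x + ∑ M, PP n M * (ac x M * (v (flp x M) - v x)) := by
  have : v x = ∑ M, PP n M * v x := by rw [← Finset.sum_mul, PP_sum, one_mul]
  conv_rhs => rw [this]
  rw [← Finset.sum_add_distrib]
  refine Finset.sum_congr rfl fun M _ => ?_
  rw [← this]
  unfold nxt ac
  split_ifs <;> ring

lemma E_dl {n : ℕ} [NeZero n] (x : BitString n) :
    ∑ M, PP n M * (ac x M * (mag (flp x M) - mag x)) = -2 * ∑ i, sg x i * pr x i := by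
  unfold pr
  simp only [Finset.mul_sum]
  rw [Finset.sum_comm]
  refine Finset.sum_congr rfl fun M _ => ?_
  rw [mag_flp]
  have : mag x - 2 * ∑ i, mm M i * sg x i - mag x = ∑ i, -2 * (mm M i * sg x i) := by
    rw [← Finset.mul_sum]; ring
  rw [this, Finset.mul_sum, Finset.mul_sum]
  exact Finset.sum_congr rfl fun i _ => by ring

lemma exp_quad (t : ℝ) (h : |t| ≤ 1) : 1 + t + t^2/4 ≤ Real.exp t := by
  have h1 := Real.exp_bound h (n := 3) (by norm_num)
  simp [Finset.sum_range_succ, Nat.factorial] at h1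
  have h2 : |t|^3 ≤ t^2 := by
    have : |t|^3 = |t|^2 * |t| := by ring
    rw [this, sq_abs]
    nlinarith [sq_nonneg t]
  have h3 := (abs_le.1 h1).1
  norm_num at h3
  nlinarith [sq_nonneg t]

lemma cosh_lin (a t : ℝ) : Real.cosh a + Real.sinh a * t ≤ Real.cosh (a + t) := by
  rw [Real.cosh_eq, Real.sinh_eq, Real.cosh_eq, neg_add, Real.exp_add, Real.exp_add]
  nlinarith [mul_le_mul_of_nonneg_left (Real.add_one_le_exp t) (Real.exp_pos a).le,
    mul_le_mul_of_nonneg_left (Real.add_one_le_exp (-t)) (Real.exp_pos (-a)).le]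

lemma cosh_quad (a t : ℝ) (h : |t| ≤ 1) :
    Real.cosh a + Real.sinh a * t + Real.cosh a * (t^2/4) ≤ Real.cosh (a + t) := by
  rw [Real.cosh_eq, Real.sinh_eq, Real.cosh_eq, neg_add, Real.exp_add, Real.exp_add]
  nlinarith [mul_le_mul_of_nonneg_left (exp_quad t h) (Real.exp_pos a).le,
    mul_le_mul_of_nonneg_left (exp_quad (-t) (by rwa [abs_neg])) (Real.exp_pos (-a)).le]

lemma abs_sinh_le (a : ℝ) : |Real.sinh a| ≤ Real.cosh a := by
  rw [Real.cosh_eq, Real.sinh_eq, abs_le]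
  have := Real.exp_pos a
  have := Real.exp_pos (-a)
  constructor <;> linarith

/-- contributions of single flips -/
lemma E_single {n : ℕ} (hn : 2 ≤ n) (w : Fin n → ℝ) (hw : ∀ i, 0 ≤ w i) :
    (∑ i, w i) / (4 * n) ≤ ∑ M, PP n M * ∑ i, w i * (if M = {i} then 1 else 0) := by
  simp only [Finset.mul_sum]
  rw [Finset.sum_comm, Finset.sum_div]
  refine Finset.sum_le_sum fun i _ => ?_
  rw [Finset.sum_eq_single {i}]
  · simp only [if_true, mul_one]
    rw [div_eq_mul_one_div, mul_comm]
    exact mul_le_mul_of_nonneg_right (PP_single hn i) (hw i)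
  · intro b _ hb
    simp [hb]
  · simp

lemma sum_ind_single {n : ℕ} (w : Fin n → ℝ) (j : Fin n) :
    ∑ i, w i * (if ({j} : Finset (Fin n)) = {i} then 1 else 0) = w j := by
  simp

lemma sum_ind_zero {n : ℕ} (w : Fin n → ℝ) (M : Finset (Fin n)) (h : ∀ i, M ≠ {i}) :
    ∑ i, w i * (if M = {i} then 1 else 0) = 0 := by
  simp [h]

lemma ac_nonneg {n : ℕ} [NeZero n] (x : BitString n) (M : Finset (Fin n)) : 0 ≤ ac x M := by
  rcases ac_cases x M with h | h <;> simp [h]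

lemma mag_flp_single {n : ℕ} (x : BitString n) (i : Fin n) : mag (flp x {i}) = mag x - 2 * sg x i := by
  rw [mag_flp]; simp [mm]

lemma cosh_pointwise {n : ℕ} [NeZero n] (hn : 2 ≤ n) (x : BitString n) (θ : ℝ) (h0 : 0 ≤ θ) (hθ : 2 * θ ≤ 1)
    (M : Finset (Fin n)) :
    θ * Real.sinh (θ * mag x) * (ac x M * (mag (flp x M) - mag x)) +
      (Real.cosh (θ * mag x) * θ^2) * ∑ i, (ZZ x i + SS x i) * (if M = {i} then 1 else 0) ≤
    ac x M * (Real.cosh (θ * mag (flp x M)) - Real.cosh (θ * mag x)) := by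
  have hz : θ * Real.sinh (θ * mag x) * (ac x M * (mag (flp x M) - mag x)) ≤
      ac x M * (Real.cosh (θ * mag (flp x M)) - Real.cosh (θ * mag x)) := by
    have h := cosh_lin (θ * mag x) (θ * (mag (flp x M) - mag x))
    have e : θ * mag x + θ * (mag (flp x M) - mag x) = θ * mag (flp x M) := by ring
    rw [e] at h
    have := mul_le_mul_of_nonneg_left h (ac_nonneg x M)
    nlinarith
  by_cases h : ∃ i, M = {i}
  swap
  · push Not at h
    rw [sum_ind_zero _ _ h, mul_zero, add_zero]
    exact hz
  obtain ⟨i, rfl⟩ := h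
  rw [sum_ind_single]
  have hac : qq x i ≤ 0 → ac x {i} = 1 := by
    intro hq
    unfold ac
    rw [if_pos]
    rw [dd_flp_single hn]; linarith
  have hmain : qq x i ≤ 0 → ZZ x i + SS x i = 1 → θ * Real.sinh (θ * mag x) * (ac x {i} * (mag (flp x {i}) - mag x)) +
      (Real.cosh (θ * mag x) * θ^2) * (ZZ x i + SS x i) ≤
    ac x {i} * (Real.cosh (θ * mag (flp x {i})) - Real.cosh (θ * mag x)) := by
    intro hq hs
    rw [hac hq, hs, mag_flp_single]
    have h := cosh_quad (θ * mag x) (-(2 * θ * sg x i)) (by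
      rw [abs_neg, abs_mul, abs_sg, mul_one, abs_of_nonneg (by positivity)]; exact hθ)
    have e : θ * mag x + -(2 * θ * sg x i) = θ * (mag x - 2 * sg x i) := by ring
    rw [e] at h
    have e2 : (-(2 * θ * sg x i))^2 / 4 = θ^2 := by
      have : sg x i ^ 2 = 1 := by rw [← sq_abs, abs_sg]; norm_num
      linear_combination θ^2 * this
    rw [e2] at h
    linarith
  rcases qq_cases x i with hq | hq | hq
  · have : ZZ x i + SS x i = 0 := by unfold ZZ SS; rw [hq]; norm_num
    rw [this, mul_zero, add_zero]; exact hz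
  · exact hmain (by rw [hq]) (by unfold ZZ SS; rw [hq]; norm_num)
  · exact hmain (by rw [hq]; norm_num) (by unfold ZZ SS; rw [hq]; norm_num)

lemma dd_pointwise {n : ℕ} [NeZero n] (hn : 2 ≤ n) (x : BitString n) (M : Finset (Fin n)) :
    2 * ∑ i, SS x i * (if M = {i} then 1 else 0) ≤ ac x M * (dd x - dd (flp x M)) := by
  have hz : 0 ≤ ac x M * (dd x - dd (flp x M)) := by
    unfold ac; split_ifs with h
    · linarith
    · simp
  by_cases h : ∃ i, M = {i}
  swap
  · push Not at h
    rw [sum_ind_zero _ _ h]; simpa using hz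
  obtain ⟨i, rfl⟩ := h
  rw [sum_ind_single]
  by_cases hq : qq x i = -1
  · have h1 : ac x {i} = 1 := by
      unfold ac
      rw [if_pos]
      rw [dd_flp_single hn]; linarith
    rw [h1, dd_flp_single hn, hq]
    simp [SS, hq]
  · simp only [SS, hq, if_false, mul_zero]; exact hz

def KK : ℝ := 84
def AA : ℝ := 2016 * Real.cosh KK

def vU {n : ℕ} [NeZero n] (x : BitString n) : ℝ :=
  (n:ℝ)^3 * (Real.cosh KK - Real.cosh (KK / n * mag x) + AA / n * dd x)

lemma cosh_le_KK {n : ℕ} [NeZero n] (x : BitString n) : Real.cosh (KK / n * mag x) ≤ Real.cosh KK := by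
  have hn : (0:ℝ) < n := by exact_mod_cast NeZero.pos n
  rw [Real.cosh_le_cosh, abs_mul]
  have hk : (0:ℝ) ≤ KK := by norm_num [KK]
  rw [abs_of_nonneg hk, abs_of_nonneg (by positivity), div_mul_eq_mul_div, div_le_iff₀ hn]
  exact mul_le_mul_of_nonneg_left (abs_mag x) hk

lemma AA_nonneg : 0 ≤ AA := by
  unfold AA
  have := Real.cosh_pos KK
  positivity

lemma vU_nonneg {n : ℕ} [NeZero n] (x : BitString n) : 0 ≤ vU x := by
  unfold vU
  have := cosh_le_KK x
  have := AA_nonneg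
  have := dd_nonneg x
  have : 0 ≤ AA / n * dd x := by positivity
  apply mul_nonneg (by positivity)
  linarith

lemma vU_opt {n : ℕ} [NeZero n] (x : BitString n) (h : isOpt x) : vU x = 0 := by
  have hn : (0:ℝ) < n := by exact_mod_cast NeZero.pos n
  have h1 : Real.cosh (KK / n * mag x) = Real.cosh KK := by
    rw [← Real.cosh_abs, abs_mul, mag_opt x h, ← Real.cosh_abs KK, abs_div, Nat.abs_cast]
    congr 1; field_simp
  unfold vU
  rw [h1, (isOpt_iff x).1 h]; ring

lemma vU_le {n : ℕ} [NeZero n] (x : BitString n) : vU x ≤ (Real.cosh KK + AA) * (n:ℝ)^3 := by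
  have hn : (0:ℝ) < n := by exact_mod_cast NeZero.pos n
  unfold vU
  have h1 := (Real.cosh_pos (KK / n * mag x)).le
  have h2 : AA / n * dd x ≤ AA := by
    rw [div_mul_eq_mul_div, div_le_iff₀ hn]
    exact mul_le_mul_of_nonneg_left (dd_le x) AA_nonneg
  rw [mul_comm]
  apply mul_le_mul_of_nonneg_right _ (by positivity)
  linarith

lemma sn_nonneg {n : ℕ} [NeZero n] (x : BitString n) : 0 ≤ sn x :=
  Finset.sum_nonneg fun i _ => SS_nonneg x i

lemma vU_step {n : ℕ} [NeZero n] (hn : 168 ≤ n) (x : BitString n) (hx : ¬ isOpt x) :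
    1 + ∑ M, PP n M * vU (nxt x M) ≤ vU x := by
  have hn' : (168:ℝ) ≤ n := by exact_mod_cast hn
  have hn0 : (0:ℝ) < n := by linarith
  rw [nxt_sum]
  set θ : ℝ := KK / n with hθ
  have hθ0 : 0 ≤ θ := by rw [hθ, KK]; positivity
  have hθ1 : 2 * θ ≤ 1 := by
    rw [hθ, KK, ← mul_div_assoc, div_le_one hn0]; linarith
  set ch := Real.cosh (θ * mag x) with hch
  set sh := Real.sinh (θ * mag x) with hsh
  have hch0 : 1 ≤ ch := Real.one_le_cosh _
  have hchK : ch ≤ Real.cosh KK := cosh_le_KK x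
  have hd := one_le_dd x hx
  have hs := sn_nonneg x
  -- first part
  have hE1 : ∑ M, PP n M * (ac x M * (Real.cosh (θ * mag (flp x M)) - ch)) ≥
      θ * sh * (-2 * ∑ i, sg x i * pr x i) + ch * θ^2 * (dd x / (4 * n)) := by
    have h1 : ∑ M, PP n M * (θ * sh * (ac x M * (mag (flp x M) - mag x)) +
      (ch * θ^2) * ∑ i, (ZZ x i + SS x i) * (if M = {i} then 1 else 0)) ≤
      ∑ M, PP n M * (ac x M * (Real.cosh (θ * mag (flp x M)) - ch)) :=
      Finset.sum_le_sum fun M _ => mul_le_mul_of_nonneg_left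
        (cosh_pointwise (by omega) x θ hθ0 hθ1 M) (PP_nonneg n M)
    refine le_trans ?_ h1
    have h2 : ∑ M, PP n M * (θ * sh * (ac x M * (mag (flp x M) - mag x)) +
      (ch * θ^2) * ∑ i, (ZZ x i + SS x i) * (if M = {i} then 1 else 0)) =
      θ * sh * ∑ M, PP n M * (ac x M * (mag (flp x M) - mag x)) + (ch * θ^2) *
        ∑ M, PP n M * ∑ i, (ZZ x i + SS x i) * (if M = {i} then 1 else 0) := by
      rw [Finset.mul_sum, Finset.mul_sum, ← Finset.sum_add_distrib]
      exact Finset.sum_congr rfl fun M _ => by ring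
    rw [h2, E_dl]
    have h3 := E_single (n := n) (by omega) (fun i => ZZ x i + SS x i)
      (fun i => add_nonneg (ZZ_nonneg x i) (SS_nonneg x i))
    have h4 : dd x / (4 * n) ≤ (∑ i, (ZZ x i + SS x i)) / (4 * n) := by
      gcongr; exact sum_ZS' x
    have h5 := mul_le_mul_of_nonneg_left (h4.trans h3) (by positivity : 0 ≤ ch * θ^2)
    linarith
  have hE2 : sn x / (2 * n) ≤ ∑ M, PP n M * (ac x M * (dd x - dd (flp x M))) := by
    have h1 : ∑ M, PP n M * (2 * ∑ i, SS x i * (if M = {i} then 1 else 0)) ≤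
      ∑ M, PP n M * (ac x M * (dd x - dd (flp x M))) :=
      Finset.sum_le_sum fun M _ => mul_le_mul_of_nonneg_left
        (dd_pointwise (by omega) x M) (PP_nonneg n M)
    have h3 := E_single (n := n) (by omega) (fun i => SS x i) (fun i => SS_nonneg x i)
    have h2 : ∑ M, PP n M * (2 * ∑ i, SS x i * (if M = {i} then 1 else 0)) =
      2 * ∑ M, PP n M * (∑ i, SS x i * (if M = {i} then 1 else 0)) := by
      rw [Finset.mul_sum]
      exact Finset.sum_congr rfl fun M _ => by ring
    rw [h2] at h1
    have e : sn x / (2 * n) = 2 * ((∑ i, SS x i) / (4 * n)) := by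
      unfold sn; field_simp; norm_num
    rw [e]
    linarith
  have hsplit : ∑ M, PP n M * (ac x M * (vU (flp x M) - vU x)) =
      - (n:ℝ)^3 * (∑ M, PP n M * (ac x M * (Real.cosh (θ * mag (flp x M)) - ch)) +
        AA / n * ∑ M, PP n M * (ac x M * (dd x - dd (flp x M)))) := by
    rw [Finset.mul_sum, ← Finset.sum_add_distrib, Finset.mul_sum]
    refine Finset.sum_congr rfl fun M _ => ?_
    unfold vU
    rw [hch]
    ring
  rw [hsplit]
  have hkey := key_bound (by omega) x hx
  have hX : θ * sh * (-2 * ∑ i, sg x i * pr x i) ≥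
      - (2 * θ * ch * (6 * sn x / n + 10 * dd x / (n:ℝ)^2)) := by
    have h1 : |θ * sh * (-2 * ∑ i, sg x i * pr x i)| ≤ 2 * θ * ch * (6 * sn x / n + 10 * dd x / (n:ℝ)^2) := by
      rw [abs_mul, abs_mul, abs_mul, abs_of_nonneg hθ0]
      have h2 : |sh| ≤ ch := abs_sinh_le _
      have h3 : |(-2:ℝ)| = 2 := by norm_num
      rw [h3]
      calc θ * |sh| * (2 * |∑ i, sg x i * pr x i|) ≤ θ * ch * (2 * (6 * sn x / n + 10 * dd x / (n:ℝ)^2)) := by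
            gcongr
        _ = _ := by ring
    exact (abs_le.1 h1).1
  have hfin : 1 / (n:ℝ)^3 ≤ θ * sh * (-2 * ∑ i, sg x i * pr x i) + ch * θ^2 * (dd x / (4 * n)) +
      AA / n * (sn x / (2 * n)) := by
    have h1 : ch * θ^2 * (dd x / (4 * n)) = 21 * (θ * ch * (dd x / (n:ℝ)^2)) := by
      rw [hθ, KK]; field_simp; norm_num
    have h2 : AA / n * (sn x / (2 * n)) = 12 * (θ * Real.cosh KK * (sn x / n)) := by
      have hk : KK = 84 := rfl
      rw [hθ, AA]
      generalize Real.cosh KK = w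
      rw [hk]
      field_simp
      ring
    have h3 : θ * ch * (sn x / n) ≤ θ * Real.cosh KK * (sn x / n) := by
      gcongr
    have h4 : 1 / (n:ℝ)^3 ≤ θ * ch * (dd x / (n:ℝ)^2) := by
      calc 1 / (n:ℝ)^3 ≤ 84 * 1 / (n:ℝ)^3 := by gcongr; norm_num
        _ = θ * 1 * (1 / (n:ℝ)^2) := by rw [hθ, KK]; field_simp
        _ ≤ _ := by gcongr
    have h5 : 2 * θ * ch * (6 * sn x / n + 10 * dd x / (n:ℝ)^2) =
      12 * (θ * ch * (sn x / n)) + 20 * (θ * ch * (dd x / (n:ℝ)^2)) := by ring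
    rw [h1, h2]
    linarith
  have hA : AA / n * (sn x / (2 * n)) ≤ AA / n * ∑ M, PP n M * (ac x M * (dd x - dd (flp x M))) :=
    mul_le_mul_of_nonneg_left hE2 (div_nonneg AA_nonneg hn0.le)
  have hG : 1 / (n:ℝ)^3 ≤ ∑ M, PP n M * (ac x M * (Real.cosh (θ * mag (flp x M)) - ch)) +
        AA / n * ∑ M, PP n M * (ac x M * (dd x - dd (flp x M))) := by linarith
  have := mul_le_mul_of_nonneg_left hG (by positivity : (0:ℝ) ≤ (n:ℝ)^3)
  rw [mul_one_div_cancel (by positivity)] at this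
  linarith

/-! ### lower bound -/

lemma acc_nonempty {n : ℕ} [NeZero n] (x : BitString n) (hx : ¬ isOpt x) (M : Finset (Fin n)) :
    ac x M * (∑ i, mm M i)^2 ≤ ∑ j, (ZZ x j + SS x j) * (mm M j * (∑ i, mm M i)^2) := by
  have hnn : ∀ j, 0 ≤ (ZZ x j + SS x j) * (mm M j * (∑ i, mm M i)^2) := fun j =>
    mul_nonneg (add_nonneg (ZZ_nonneg x j) (SS_nonneg x j)) (mul_nonneg (mm_nonneg M j) (sq_nonneg _))
  have hS := Finset.sum_nonneg fun j (_ : j ∈ Finset.univ) => hnn j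
  by_cases ha : dd (flp x M) ≤ dd x
  swap
  · have : ac x M = 0 := by simp [ac, ha]
    rw [this, zero_mul]; exact hS
  rcases M.eq_empty_or_nonempty with h | ⟨i, hi⟩
  · have : ∑ i, mm M i = 0 := Finset.sum_eq_zero fun i _ => by rw [h]; simp [mm]
    rw [this] at hS ⊢
    simp
  have e2 : ac x M = 1 := by simp [ac, ha]
  have : ∃ j ∈ M, ZZ x j + SS x j = 1 := by
    rcases qq_cases x i with h | h | h
    · obtain ⟨j, hj, h1 | h1⟩ := acc_interior x M hx ha i hi h
      · exact ⟨j, hj, by unfold ZZ SS; rw [h1]; norm_num⟩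
      · exact ⟨j, hj, by unfold ZZ SS; rw [h1.1]; norm_num⟩
    · exact ⟨i, hi, by unfold ZZ SS; rw [h]; norm_num⟩
    · exact ⟨i, hi, by unfold ZZ SS; rw [h]; norm_num⟩
  obtain ⟨j, hj, h⟩ := this
  refine le_trans (le_of_eq ?_) (Finset.single_le_sum (fun j _ => hnn j) (Finset.mem_univ j))
  rw [h, e2, mm_one.2 hj]; ring

lemma E_cube {n : ℕ} (j : Fin n) : ∑ M, PP n M * (mm M j * (∑ i, mm M i)^2) ≤ 5 / n := by
  have hn : (0:ℝ) < n := by exact_mod_cast j.pos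
  have e : ∑ M, PP n M * (mm M j * (∑ i, mm M i)^2) =
      ∑ k, ∑ i, ∑ M, PP n M * (mm M i * mm M j * mm M k) := by
    rw [Finset.sum_congr rfl fun k _ => Finset.sum_comm, Finset.sum_comm]
    refine Finset.sum_congr rfl fun M _ => ?_
    rw [sq, Finset.sum_mul_sum, Finset.mul_sum, Finset.mul_sum]
    refine Finset.sum_congr rfl fun k _ => ?_
    rw [Finset.mul_sum, Finset.mul_sum]
    exact Finset.sum_congr rfl fun i _ => by ring
  have hk : ∀ k, ∑ i, ∑ M, PP n M * (mm M i * mm M j * mm M k) ≤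
      3 / (n:ℝ)^2 + if k = j then 2 / (n:ℝ) else 0 := by
    intro k
    by_cases h : k = j
    · subst h
      rw [if_pos rfl]
      have : ∀ i, ∑ M, PP n M * (mm M i * mm M k * mm M k) ≤ 1 / (n:ℝ)^2 + if i = k then 1 / (n:ℝ) else 0 := by
        intro i
        have e1 : ∑ M, PP n M * (mm M i * mm M k * mm M k) = ∑ M, PP n M * (mm M i * mm M k) :=
          Finset.sum_congr rfl fun M _ => by rw [mul_assoc, mm_sq]
        rw [e1]
        by_cases hi : i = k
        · subst hi
          have e2 : ∑ M, PP n M * (mm M i * mm M i) = ∑ M, PP n M * (mm M i) :=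
            Finset.sum_congr rfl fun M _ => by rw [mm_sq]
          rw [e2, E_m, if_pos rfl]
          have : (0:ℝ) ≤ 1 / (n:ℝ)^2 := by positivity
          linarith
        · rw [E_mm _ _ hi, if_neg hi, add_zero]
      refine (Finset.sum_le_sum fun i _ => this i).trans ?_
      rw [Finset.sum_add_distrib]
      have e3 : (n:ℝ) * (1 / (n:ℝ)^2) = 1 / n := by field_simp
      simp only [Finset.sum_const, Finset.card_univ, Fintype.card_fin, nsmul_eq_mul, Finset.sum_ite_eq',
        Finset.mem_univ, if_true, e3]
      have : (0:ℝ) ≤ 3 / (n:ℝ)^2 := by positivity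
      have e4 : 2 / (n:ℝ) = 1 / n + 1 / n := by ring
      linarith
    · rw [if_neg h, add_zero, ← Finset.add_sum_erase _ _ (Finset.mem_univ j)]
      have h1 := sum_E_mmm j k (Ne.symm h)
      have e1 : ∑ M, PP n M * (mm M j * mm M j * mm M k) = 1 / (n:ℝ)^2 := by
        rw [← E_mm j k (Ne.symm h)]
        exact Finset.sum_congr rfl fun M _ => by rw [mm_sq]
      rw [e1]
      have e4 : 3 / (n:ℝ)^2 = 1 / (n:ℝ)^2 + 2 / (n:ℝ)^2 := by ring
      linarith
  rw [e]
  refine (Finset.sum_le_sum fun k _ => hk k).trans (le_of_eq ?_)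
  rw [Finset.sum_add_distrib]
  simp
  field_simp
  norm_num

lemma E_sq {n : ℕ} [NeZero n] (x : BitString n) (hx : ¬ isOpt x) (hd : dd x ≤ 2) :
    ∑ M, PP n M * (ac x M * (mag (flp x M) - mag x)^2) ≤ 80 / n := by
  have hn : (0:ℝ) < n := by exact_mod_cast NeZero.pos n
  have h1 : ∀ M, ac x M * (mag (flp x M) - mag x)^2 ≤
      4 * ∑ j, (ZZ x j + SS x j) * (mm M j * (∑ i, mm M i)^2) := by
    intro M
    refine le_trans ?_ (mul_le_mul_of_nonneg_left (acc_nonempty x hx M) (by norm_num))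
    have h2 : |∑ i, mm M i * sg x i| ≤ ∑ i, mm M i := by
      refine (Finset.abs_sum_le_sum_abs _ _).trans (Finset.sum_le_sum fun i _ => ?_)
      rw [abs_mul, abs_sg, mul_one, abs_of_nonneg (mm_nonneg M i)]
    have h3 : (∑ i, mm M i * sg x i)^2 ≤ (∑ i, mm M i)^2 := by
      rw [← sq_abs]; exact pow_le_pow_left₀ (abs_nonneg _) h2 2
    rw [mag_flp]
    have := mul_le_mul_of_nonneg_left h3 (ac_nonneg x M)
    nlinarith
  calc _ ≤ ∑ M, PP n M * (4 * ∑ j, (ZZ x j + SS x j) * (mm M j * (∑ i, mm M i)^2)) :=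
        Finset.sum_le_sum fun M _ => mul_le_mul_of_nonneg_left (h1 M) (PP_nonneg n M)
    _ = 4 * ∑ j, (ZZ x j + SS x j) * ∑ M, PP n M * (mm M j * (∑ i, mm M i)^2) := by
        have : ∑ j, (ZZ x j + SS x j) * ∑ M, PP n M * (mm M j * (∑ i, mm M i)^2) =
          ∑ M, PP n M * ∑ j, (ZZ x j + SS x j) * (mm M j * (∑ i, mm M i)^2) := by
          simp only [Finset.mul_sum (s := (Finset.univ : Finset (Finset (Fin n))))]
          rw [Finset.sum_comm]
          refine Finset.sum_congr rfl fun M _ => ?_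
          rw [Finset.mul_sum]
          exact Finset.sum_congr rfl fun j _ => by ring
        rw [this, Finset.mul_sum]
        exact Finset.sum_congr rfl fun M _ => by ring
    _ ≤ 4 * ∑ j, (ZZ x j + SS x j) * (5 / n) := by
        gcongr with j _
        · exact add_nonneg (ZZ_nonneg x j) (SS_nonneg x j)
        · exact E_cube j
    _ = 4 * ((∑ j, (ZZ x j + SS x j)) * (5 / n)) := by rw [Finset.sum_mul]
    _ ≤ 4 * (4 * (5 / n)) := by
        gcongr
        have := sum_ZS x
        linarith
    _ = 80 / n := by ring

lemma sn_zero {n : ℕ} [NeZero n] (hn : 2 ≤ n) (x : BitString n) (hd : dd x ≤ 2) (hm : |mag x| < n - 2) :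
    sn x = 0 := by
  refine Finset.sum_eq_zero fun i _ => ?_
  unfold SS
  rw [if_neg]
  intro hq
  have h1 := dd_flp_single hn x i
  have h2 := dd_nonneg (flp x {i})
  have h3 : isOpt (flp x {i}) := by rw [isOpt_iff]; linarith
  have h4 := mag_opt _ h3
  rw [mag_flp_single] at h4
  have h5 : |mag x - 2 * sg x i| ≤ |mag x| + 2 := by
    refine (abs_sub _ _).trans ?_
    rw [abs_mul, abs_sg]; norm_num
  linarith

lemma drift_sq {n : ℕ} [NeZero n] (hn : 4 ≤ n) (x : BitString n) (hx : ¬ isOpt x) (hd : dd x ≤ 2)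
    (hm : |mag x| < n - 2) :
    ∑ M, PP n M * (ac x M * (mag (flp x M)^2 - mag x^2)) ≤ 160 / n := by
  have hn0 : (0:ℝ) < n := by exact_mod_cast NeZero.pos n
  have e : ∑ M, PP n M * (ac x M * (mag (flp x M)^2 - mag x^2)) =
      2 * mag x * ∑ M, PP n M * (ac x M * (mag (flp x M) - mag x)) +
      ∑ M, PP n M * (ac x M * (mag (flp x M) - mag x)^2) := by
    rw [Finset.mul_sum, ← Finset.sum_add_distrib]
    exact Finset.sum_congr rfl fun M _ => by ring
  rw [e, E_dl]
  have h1 := E_sq x hx hd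
  have h2 := key_bound hn x hx
  rw [sn_zero (by omega) x hd hm] at h2
  have h3 : |2 * mag x * (-2 * ∑ i, sg x i * pr x i)| ≤ 80 / n := by
    rw [abs_mul, abs_mul, abs_mul]
    have h4 : |(-2:ℝ)| = 2 := by norm_num
    have h5 : |(2:ℝ)| = 2 := by norm_num
    rw [h4, h5]
    calc 2 * |mag x| * (2 * |∑ i, sg x i * pr x i|) ≤ 2 * n * (2 * (10 * 2 / (n:ℝ)^2)) := by
          gcongr
          · exact abs_mag x
          · refine h2.trans ?_
            simp only [mul_zero, zero_div, zero_add]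
            gcongr
      _ = 80 / n := by field_simp; norm_num
  have h4 := (abs_le.1 h3).2
  have e4 : 160 / (n:ℝ) = 80 / n + 80 / n := by ring
  linarith

def vL {n : ℕ} [NeZero n] (M0 : ℝ) (x : BitString n) : ℝ :=
  if dd x ≤ 2 then (n:ℝ) / 160 * max 0 (M0^2 - mag x^2) else 0

lemma vL_nonneg {n : ℕ} [NeZero n] (M0 : ℝ) (x : BitString n) : 0 ≤ vL M0 x := by
  unfold vL; split_ifs <;> positivity

lemma vL_step {n : ℕ} [NeZero n] (hn : 4 ≤ n) (M0 : ℝ) (h0 : 0 ≤ M0) (hM : M0 ≤ n - 2) (x : BitString n)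
    (hx : ¬ isOpt x) : vL M0 x ≤ 1 + ∑ M, PP n M * vL M0 (nxt x M) := by
  have hn0 : (0:ℝ) < n := by exact_mod_cast NeZero.pos n
  have hS : 0 ≤ ∑ M, PP n M * vL M0 (nxt x M) :=
    Finset.sum_nonneg fun M _ => mul_nonneg (PP_nonneg n M) (vL_nonneg _ _)
  by_cases hd : dd x ≤ 2
  swap
  · have : vL M0 x = 0 := by simp [vL, hd]
    rw [this]; linarith
  by_cases hm : M0^2 ≤ mag x^2
  · have : vL M0 x = 0 := by
      unfold vL; rw [if_pos hd, max_eq_left (by linarith), mul_zero]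
    rw [this]; linarith
  push Not at hm
  have hm2 : |mag x| < n - 2 := lt_of_lt_of_le (abs_lt_of_sq_lt_sq hm h0) hM
  have h1 : ∑ M, PP n M * ((n:ℝ) / 160 * (M0^2 - mag (nxt x M)^2)) ≤ ∑ M, PP n M * vL M0 (nxt x M) := by
    refine Finset.sum_le_sum fun M _ => mul_le_mul_of_nonneg_left ?_ (PP_nonneg n M)
    have : dd (nxt x M) ≤ 2 := by
      unfold nxt; split_ifs with h
      · linarith
      · exact hd
    unfold vL
    rw [if_pos this]
    gcongr
    exact le_max_right _ _
  refine le_trans ?_ (add_le_add_right h1 1)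
  rw [nxt_sum x (fun y => (n:ℝ) / 160 * (M0^2 - mag y^2))]
  have e : ∑ M, PP n M * (ac x M * ((n:ℝ) / 160 * (M0^2 - mag (flp x M)^2) - (n:ℝ) / 160 * (M0^2 - mag x^2))) =
      - ((n:ℝ) / 160) * ∑ M, PP n M * (ac x M * (mag (flp x M)^2 - mag x^2)) := by
    rw [Finset.mul_sum]
    exact Finset.sum_congr rfl fun M _ => by ring
  rw [e]
  have h2 := mul_le_mul_of_nonneg_left (drift_sq hn x hx hd hm2) (by positivity : (0:ℝ) ≤ (n:ℝ) / 160)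
  have h3 : (n:ℝ) / 160 * (160 / n) = 1 := by field_simp
  have h4 : vL M0 x = (n:ℝ) / 160 * (M0^2 - mag x^2) := by
    unfold vL; rw [if_pos hd, max_eq_right (by linarith)]
  rw [h4]
  linarith

lemma vL_opt {n : ℕ} [NeZero n] (M0 : ℝ) (h0 : 0 ≤ M0) (hM : M0 ≤ n) (x : BitString n)
    (hx : isOpt x) : vL M0 x = 0 := by
  unfold vL
  split_ifs
  · have h1 : mag x^2 = (n:ℝ)^2 := by rw [← sq_abs, mag_opt x hx]
    rw [h1, max_eq_left, mul_zero]
    nlinarith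
  · rfl

lemma vL_le {n : ℕ} [NeZero n] (M0 : ℝ) (x : BitString n) : vL M0 x ≤ (n:ℝ) / 160 * M0^2 := by
  unfold vL
  split_ifs
  · gcongr
    apply max_le (sq_nonneg _)
    nlinarith [sq_nonneg (mag x)]
  · positivity

lemma dd_block {n : ℕ} [NeZero n] (ε : ℝ) : dd (blockInit n ε) ≤ 2 := by
  have hpos := NeZero.pos n
  set k := ⌊ε * n⌋₊ with hk
  have h : ∀ i : Fin n, Dd (blockInit n ε) i ≤ (if i.val = k - 1 then 1 else 0) + (if i.val = n - 1 then 1 else 0) := by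
    intro i
    unfold Dd blockInit
    rw [← hk]
    split_ifs with h1 h2 h3 h3 h2 h3 <;> norm_num
    apply h1
    have hi := i.isLt
    have : (i + 1).val = i.val + 1 := by
      rw [Fin.val_add, Fin.val_one', Nat.add_mod_mod, Nat.mod_eq_of_lt (by omega)]
    rw [this]
    congr 1
    apply propext
    constructor <;> intro <;> omega
  have hs : ∀ a : ℕ, ∑ i : Fin n, (if i.val = a then (1:ℝ) else 0) ≤ 1 := by
    intro a
    rw [← Finset.sum_filter, Finset.sum_const, nsmul_eq_mul, mul_one]
    have : (Finset.univ.filter fun i : Fin n => i.val = a).card ≤ 1 := by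
      rw [Finset.card_le_one]
      intro i hi j hj
      simp at hi hj
      ext; omega
    exact_mod_cast this
  refine (Finset.sum_le_sum fun i _ => h i).trans ?_
  rw [Finset.sum_add_distrib]
  linarith [hs (k-1), hs (n-1)]

lemma mag_block {n : ℕ} (ε : ℝ) (hk : ⌊ε * n⌋₊ ≤ n) : mag (blockInit n ε) = 2 * (⌊ε * n⌋₊ : ℝ) - n := by
  set k := ⌊ε * n⌋₊ with hk'
  have h : ∀ i : Fin n, sg (blockInit n ε) i = 2 * (if i.val < k then 1 else 0) - 1 := by
    intro i
    unfold sg blockInit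
    rw [← hk']
    by_cases h : i.val < k <;> simp [h] <;> norm_num
  unfold mag
  simp only [h]
  rw [Finset.sum_sub_distrib, ← Finset.mul_sum, ← Finset.sum_filter]
  have : (Finset.univ.filter fun i : Fin n => i.val < k).card = k := by
    rw [Fin.card_filter_val_lt]; omega
  simp [this]

theorem upper_main (n : ℕ) (hn : 168 ≤ n) (init : State n → ℝ≥0∞)
    (hi : ∀ s, isOpt s.1 → s.2 = false → init s = 0) (hi1 : ∑ s, init s ≤ 1) :
    expOpt init ≤ ENNReal.ofReal ((Real.cosh KK + AA) * (n:ℝ)^3) := by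
  haveI : NeZero n := ⟨by omega⟩
  exact expOpt_upper vU vU_nonneg vU_opt (fun x hx => vU_step hn x hx) init _ vU_le hi hi1

theorem lower_main (n : ℕ) (hn : 4 ≤ n) (ε : ℝ) (hε : 0 < ε) (hε2 : ε < 1/2) (hn2 : 4 / ε ≤ n) :
    ENNReal.ofReal (ε / 640 * (n:ℝ)^3) ≤ expOpt (initAt (blockInit n ε)) := by
  haveI : NeZero n := ⟨by omega⟩
  have hn0 : (0:ℝ) < n := by exact_mod_cast NeZero.pos n
  have hen : 4 ≤ ε * n := by
    rw [div_le_iff₀ hε] at hn2; linarith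
  set M0 : ℝ := (1 - ε) * n with hM0
  have hfl : (⌊ε * n⌋₊ : ℝ) ≤ ε * n := Nat.floor_le (by positivity)
  have hfl2 : ε * n < ⌊ε * n⌋₊ + 1 := Nat.lt_floor_add_one _
  have hkn : ⌊ε * n⌋₊ ≤ n := by
    have : (⌊ε * n⌋₊ : ℝ) ≤ n := by nlinarith
    exact_mod_cast this
  have hmag := mag_block ε hkn
  have hM00 : 0 ≤ M0 := by
    apply mul_nonneg _ hn0.le; linarith
  have hM0n : M0 ≤ n - 2 := by rw [hM0]; linarith
  set m := mag (blockInit n ε) with hm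
  have hm1 : m ≤ 0 := by rw [hmag]; nlinarith
  have hm2 : -m ≤ (1 - 3/2 * ε) * n := by rw [hmag]; linarith
  have hgap : ε / 4 * (n:ℝ)^2 ≤ M0^2 - m^2 := by
    have h1 : ε / 2 * n ≤ M0 - (-m) := by rw [hM0]; linarith
    have h2 : 1/2 * (n:ℝ) ≤ M0 + (-m) := by rw [hM0]; nlinarith
    have h3 := mul_le_mul h1 h2 (by positivity) (by linarith [mul_nonneg hε.le hn0.le])
    nlinarith
  have hopt : ¬ isOpt (blockInit n ε) := by
    intro h
    have h1 := mag_opt _ h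
    rw [← hm, abs_of_nonpos hm1] at h1
    nlinarith
  refine le_trans (ENNReal.ofReal_le_ofReal ?_) (expOpt_lower (vL M0) (vL_nonneg M0)
    (fun y hy => vL_opt M0 hM00 (by linarith) y hy) (fun y hy => vL_step hn M0 hM00 hM0n y hy) _
    (vL_le M0) _ hopt)
  unfold vL
  rw [if_pos (dd_block ε), ← hm]
  calc ε / 640 * (n:ℝ)^3 = (n:ℝ) / 160 * (ε / 4 * (n:ℝ)^2) := by ring
    _ ≤ (n:ℝ) / 160 * max 0 (M0^2 - m^2) := by
      gcongr
      exact le_trans hgap (le_max_right _ _)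

/-- adapting Theorems 4 and 5 in Fischer–Wegener: the expected
optimization time of the (1+1) EA for the Ising model / 2-coloring problem on the ring
with an even number n of vertices is O(n³), and it is Θ(n³) when starting from a
coloring consisting of two monochromatic blocks of lengths εn and (1−ε)n for a
constant 0 < ε < 1/2. -/
theorem oneOneEA_Ising_ring :
    (∃ C : ℝ, 0 < C ∧ ∀ᶠ n : ℕ in atTop, Even n →
      expOpt (initU n) ≤ ENNReal.ofReal (C * (n : ℝ) ^ 3)) ∧
    ∀ ε : ℝ, 0 < ε → ε < 1 / 2 →
      ∃ c C : ℝ, 0 < c ∧ 0 < C ∧ ∀ᶠ n : ℕ in atTop, Even n →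
        ENNReal.ofReal (c * (n : ℝ) ^ 3) ≤ expOpt (initAt (blockInit n ε)) ∧
        expOpt (initAt (blockInit n ε)) ≤ ENNReal.ofReal (C * (n : ℝ) ^ 3) := by
  have hC : 0 < Real.cosh KK + AA := by
    have := Real.cosh_pos KK
    have := AA_nonneg
    linarith
  refine ⟨⟨Real.cosh KK + AA, hC, ?_⟩, ?_⟩
  · filter_upwards [eventually_ge_atTop 168] with n hn _
    exact upper_main n hn _ (initU_opt n) (initU_sum n)
  · intro ε hε hε2
    refine ⟨ε / 640, Real.cosh KK + AA, by positivity, hC, ?_⟩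
    filter_upwards [eventually_ge_atTop 168, eventually_ge_atTop ⌈4 / ε⌉₊] with n hn hn2 _
    exact ⟨lower_main n (by omega) ε hε hε2 (Nat.ceil_le.1 hn2),
      upper_main n hn _ (initAt_opt _) (initAt_sum _)⟩

end Stmt15
end
end
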